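/- Let σ with vertices v₁,…,v_ℓ (in order along σ) be a δ-signature of a polygonal curve τ. Let r_j = [v_j − δ, v_j + δ] for 2 ≤ j ≤ ℓ−1, and let r₁ = [v₁ − 4δ, v₁ + 4δ] and r_ℓ = [v_ℓ − 4δ, v_ℓ + 4δ]. Let π be a polygonal curve with d_F(τ, π) ≤ δ, and let π' be the polygonal curve obtained from π by removing one interior vertex u of π with u ∉ ⋃_{1 ≤ j ≤ ℓ} r_j. Then d_F(τ, π') ≤ δ. -/

import Mathlib

open Set

/-- A valid reparametrization of `[0,1]`: a continuous strictly increasing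
bijection of `[0,1]` onto itself fixing the endpoints. -/
def IsReparam (f : ℝ → ℝ) : Prop :=
  ContinuousOn f (Set.Icc 0 1) ∧ StrictMonoOn f (Set.Icc 0 1) ∧ f 0 = 0 ∧ f 1 = 1

/-- The Fréchet distance between two curves `τ, π : [0,1] → ℝ`:
`inf_f sup_{t ∈ [0,1]} |τ(f(t)) - π(t)|` over reparametrizations `f`. -/
noncomputable def frechetDist (τ π : ℝ → ℝ) : ℝ :=
  ⨅ f : {f : ℝ → ℝ // IsReparam f}, ⨆ t : Set.Icc (0:ℝ) 1, |τ (f.1 ↑t) - π ↑t|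

/-- `τ` is the polygonal curve on `[0,1]` with the `m` vertices `w 0, …, w (m-1)`
attained at parameters `t 0 = 0 < t 1 < … < t (m-1) = 1`, obtained by linear
interpolation. -/
def IsPolyOn (τ : ℝ → ℝ) (m : ℕ) (t w : ℕ → ℝ) : Prop :=
  2 ≤ m ∧ t 0 = 0 ∧ t (m - 1) = 1 ∧ (∀ i, i + 1 < m → t i < t (i + 1)) ∧
  (∀ i, i + 1 < m → ∀ u ∈ Set.Icc (t i) (t (i + 1)),
    τ u = w i + (u - t i) / (t (i + 1) - t i) * (w (i + 1) - w i))

/-- `τ` is a polygonal curve (with finitely many vertices). -/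
def IsPolyCurve (τ : ℝ → ℝ) : Prop := ∃ m t w, IsPolyOn τ m t w

/-- `c` is a polygonal curve with at most `ℓ` vertices, i.e. an element of `Δ_ℓ`. -/
def InDeltaL (ℓ : ℕ) (c : ℝ → ℝ) : Prop := ∃ m t w, m ≤ ℓ ∧ IsPolyOn c m t w

/-- General position of the vertex sequence `w 0, …, w (m-1)`: pairwise distinct
vertex values, pairwise distinct differences, and no vertex inside the closed
interval spanned by its two neighbours. -/
def GenPos (m : ℕ) (w : ℕ → ℝ) : Prop :=
  (∀ i j, i < m → j < m → i ≠ j → w i ≠ w j) ∧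
  (∀ i j p q, i < m → j < m → p < m → q < m → i ≠ j → p ≠ q →
      (i, j) ≠ (p, q) → w i - w j ≠ w p - w q) ∧
  (∀ i, i + 2 < m → w (i + 1) ∉ Set.uIcc (w i) (w (i + 2)))

/-- The parameters `s 0 = 0 < s 1 < … < s (ℓ-1) = 1` define a `δ`-signature of the
curve `τ` (Definition 3.3 of the paper, `0`-indexed): non-degeneracy,
direction-preservation, minimum edge length and range conditions. -/
def IsSignature (δ : ℝ) (τ : ℝ → ℝ) (ℓ : ℕ) (s : ℕ → ℝ) : Prop :=
  2 ≤ ℓ ∧ s 0 = 0 ∧ s (ℓ - 1) = 1 ∧ (∀ i, i + 1 < ℓ → s i < s (i + 1)) ∧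
  (∀ i, 1 ≤ i → i + 1 < ℓ → τ (s i) ∉ Set.uIcc (τ (s (i - 1))) (τ (s (i + 1)))) ∧
  (∀ i, i + 1 < ℓ → ∀ a b : ℝ, s i ≤ a → a < b → b ≤ s (i + 1) →
      (τ (s i) < τ (s (i + 1)) → τ a - τ b ≤ 2 * δ) ∧
      (τ (s (i + 1)) < τ (s i) → τ b - τ a ≤ 2 * δ)) ∧
  (∀ i, 1 ≤ i → i + 3 ≤ ℓ → 2 * δ < |τ (s (i + 1)) - τ (s i)|) ∧
  δ < |τ (s 1) - τ (s 0)| ∧ δ < |τ (s (ℓ - 1)) - τ (s (ℓ - 2))| ∧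
  (∀ i, 1 ≤ i → i + 3 ≤ ℓ → ∀ a ∈ Set.Icc (s i) (s (i + 1)),
      τ a ∈ Set.uIcc (τ (s i)) (τ (s (i + 1)))) ∧
  (2 < ℓ → ∀ a ∈ Set.Icc (s 0) (s 1),
      τ a ∈ Set.uIcc (τ (s 0)) (τ (s 1)) ∪ Set.Icc (τ (s 0) - δ) (τ (s 0) + δ)) ∧
  (2 < ℓ → ∀ a ∈ Set.Icc (s (ℓ - 2)) (s (ℓ - 1)),
      τ a ∈ Set.uIcc (τ (s (ℓ - 2))) (τ (s (ℓ - 1))) ∪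
        Set.Icc (τ (s (ℓ - 1)) - δ) (τ (s (ℓ - 1)) + δ)) ∧
  (ℓ = 2 → ∀ a ∈ Set.Icc (s 0) (s 1),
      τ a ∈ Set.uIcc (τ (s 0)) (τ (s 1)) ∪ Set.Icc (τ (s 0) - δ) (τ (s 0) + δ) ∪
        Set.Icc (τ (s 1) - δ) (τ (s 1) + δ))

open Relation

/-- First time at which a continuous function that starts at or below `v` hits `v`. -/
lemma exists_first_hit_up {g : ℝ → ℝ} (hg : Continuous g) {x y v : ℝ} (hxy : x ≤ y)
    (hx : g x ≤ v) (hy : v ≤ g y) :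
    ∃ z ∈ Icc x y, g z = v ∧ ∀ t ∈ Icc x z, g t ≤ v := by
  have hne : (Icc x y ∩ g ⁻¹' {v}).Nonempty := by
    obtain ⟨z, hz, hzv⟩ := intermediate_value_Icc hxy hg.continuousOn ⟨hx, hy⟩
    exact ⟨z, hz, hzv⟩
  have hcomp : IsCompact (Icc x y ∩ g ⁻¹' {v}) :=
    isCompact_Icc.inter_right (isClosed_singleton.preimage hg)
  obtain ⟨z, ⟨hz, hzv⟩, hleast⟩ := hcomp.exists_isLeast hne
  refine ⟨z, hz, hzv, fun t ht => ?_⟩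
  by_contra! hlt
  obtain ⟨r, hr, hrv⟩ := intermediate_value_Icc ht.1 hg.continuousOn ⟨hx, hlt.le⟩
  have hzr : z ≤ r := hleast ⟨⟨hr.1, hr.2.trans (ht.2.trans hz.2)⟩, hrv⟩
  have htz : t = z := le_antisymm ht.2 (hzr.trans hr.2)
  rw [htz, show g z = v from hzv] at hlt
  exact lt_irrefl _ hlt

/-- Last time at which a continuous function that ends at or above `v` hits `v`. -/
lemma exists_last_hit_up {g : ℝ → ℝ} (hg : Continuous g) {x y v : ℝ} (hxy : x ≤ y)
    (hx : g x ≤ v) (hy : v ≤ g y) :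
    ∃ z ∈ Icc x y, g z = v ∧ ∀ t ∈ Icc z y, v ≤ g t := by
  obtain ⟨z, hz, hzv, h⟩ := exists_first_hit_up (g := fun t => -g (-t)) (x := -y) (y := -x)
    (v := -v) (by fun_prop) (neg_le_neg hxy) (by simpa using hy) (by simpa using hx)
  refine ⟨-z, ⟨by linarith [hz.2], by linarith [hz.1]⟩, by linarith, fun t ht => ?_⟩
  have := h (-t) ⟨by linarith [ht.2], by linarith [ht.1]⟩
  simpa using this

lemma exists_first_hit_down {g : ℝ → ℝ} (hg : Continuous g) {x y v : ℝ} (hxy : x ≤ y)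
    (hx : v ≤ g x) (hy : g y ≤ v) :
    ∃ z ∈ Icc x y, g z = v ∧ ∀ t ∈ Icc x z, v ≤ g t := by
  obtain ⟨z, hz, hzv, h⟩ := exists_first_hit_up hg.neg (v := -v) hxy (neg_le_neg hx)
    (neg_le_neg hy)
  exact ⟨z, hz, neg_inj.1 hzv, fun t ht => neg_le_neg_iff.1 (h t ht)⟩

lemma exists_last_hit_down {g : ℝ → ℝ} (hg : Continuous g) {x y v : ℝ} (hxy : x ≤ y)
    (hx : v ≤ g x) (hy : g y ≤ v) :
    ∃ z ∈ Icc x y, g z = v ∧ ∀ t ∈ Icc z y, g t ≤ v := by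
  obtain ⟨z, hz, hzv, h⟩ := exists_last_hit_up hg.neg (v := -v) hxy (neg_le_neg hx)
    (neg_le_neg hy)
  exact ⟨z, hz, neg_inj.1 hzv, fun t ht => neg_le_neg_iff.1 (h t ht)⟩

/-- A monotone straight segment from `P` to `Q` inside the `κ`-free space of `τ` and `ρ`. -/
def FreeSegment (κ : ℝ) (τ ρ : ℝ → ℝ) (P Q : ℝ × ℝ) : Prop :=
  P.1 ≤ Q.1 ∧ P.2 ≤ Q.2 ∧
    ∀ θ ∈ Icc (0 : ℝ) 1, |τ (P.1 + θ * (Q.1 - P.1)) - ρ (P.2 + θ * (Q.2 - P.2))| ≤ κ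

/-- `Q` is reachable from `P` by a monotone polygonal path in the `κ`-free space. -/
abbrev FreePath (κ : ℝ) (τ ρ : ℝ → ℝ) : ℝ × ℝ → ℝ × ℝ → Prop :=
  ReflTransGen (FreeSegment κ τ ρ)

lemma affine_mem_Icc {x y θ : ℝ} (hxy : x ≤ y) (hθ : θ ∈ Icc (0 : ℝ) 1) :
    x + θ * (y - x) ∈ Icc x y :=
  ⟨by nlinarith [hθ.1, hθ.2], by nlinarith [hθ.1, hθ.2]⟩

lemma freePath_vertical {κ : ℝ} {τ ρ : ℝ → ℝ} {x y y' : ℝ} (hy : y ≤ y')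
    (h : ∀ b ∈ Icc y y', |τ x - ρ b| ≤ κ) : FreePath κ τ ρ (x, y) (x, y') := by
  refine ReflTransGen.single ⟨le_rfl, hy, fun θ hθ => ?_⟩
  simpa using h _ (affine_mem_Icc hy hθ)

lemma freePath_horizontal {κ : ℝ} {τ ρ : ℝ → ℝ} {x x' y : ℝ} (hx : x ≤ x')
    (h : ∀ a ∈ Icc x x', |τ a - ρ y| ≤ κ) : FreePath κ τ ρ (x, y) (x', y) := by
  refine ReflTransGen.single ⟨hx, le_rfl, fun θ hθ => ?_⟩
  simpa using h _ (affine_mem_Icc hx hθ)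

lemma freePath_diagonal {κ : ℝ} {τ ρ : ℝ → ℝ} {x x' : ℝ} (hx : x ≤ x')
    (h : ∀ a ∈ Icc x x', |τ a - ρ a| ≤ κ) : FreePath κ τ ρ (x, x) (x', x') :=
  ReflTransGen.single ⟨hx, hx, fun _ hθ => h _ (affine_mem_Icc hx hθ)⟩

lemma FreePath.neg {κ : ℝ} {τ ρ : ℝ → ℝ} {P Q : ℝ × ℝ}
    (h : FreePath κ (fun x => -τ x) (fun x => -ρ x) P Q) : FreePath κ τ ρ P Q := by
  have hle : FreeSegment κ (fun x => -τ x) (fun x => -ρ x) ≤ FreeSegment κ τ ρ := by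
    refine fun A B hAB => ⟨hAB.1, hAB.2.1, fun θ hθ => ?_⟩
    rw [← abs_neg]
    convert hAB.2.2 θ hθ using 2
    ring
  exact ReflTransGen.mono hle _ _ h

lemma FreePath.reverse {κ : ℝ} {τ ρ : ℝ → ℝ} {P Q : ℝ × ℝ}
    (h : FreePath κ (fun x => τ (1 - x)) (fun x => ρ (1 - x)) P Q) :
    FreePath κ τ ρ (1 - Q.1, 1 - Q.2) (1 - P.1, 1 - P.2) := by
  induction h with
  | refl => exact ReflTransGen.refl
  | @tail A B _ hAB ih =>
    refine ReflTransGen.head ⟨sub_le_sub_left hAB.1 1, sub_le_sub_left hAB.2.1 1, fun θ hθ => ?_⟩ ih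
    convert hAB.2.2 (1 - θ) ⟨by linarith [hθ.2], by linarith [hθ.1]⟩ using 4 <;> ring

/-- Two curves that climb from level `l` to level `h`: `τ` loses at most `2δ` on the way and
ranges around `[l + δ, h + δ]`, while `ρ` stays in a band `[l, h]` of height at most `2δ`. -/
lemma freePath_climb {τ ρ : ℝ → ℝ} (hτ : Continuous τ) (hρ : Continuous ρ)
    {δ κ l h y₀ y₁ z₀ z₁ zm : ℝ} (hκ : δ < κ) (hy : y₀ ≤ y₁)
    (hτ₀ : τ y₀ = l + δ) (hτ₁ : τ y₁ = h + δ) (hmax : ∀ t ∈ Icc y₀ y₁, τ t ≤ h + δ)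
    (hdrop : ∀ s t, y₀ ≤ s → s ≤ t → t ≤ y₁ → τ s - τ t ≤ 2 * δ)
    (hband : ∀ z ∈ Icc z₀ z₁, l ≤ ρ z ∧ ρ z ≤ h) (hh : h ≤ l + 2 * δ)
    (hzm : zm ∈ Icc z₀ z₁) (hρm : ρ zm = l) (hρ₁ : ρ z₁ = h) :
    FreePath κ τ ρ (y₀, z₀) (y₁, z₁) := by
  have hlh : l ≤ h := hρm ▸ (hband zm hzm).2
  have level : ∀ k : ℕ, ∃ y ∈ Icc y₀ y₁, ∃ z ∈ Icc z₀ z₁,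
      FreePath κ τ ρ (y₀, z₀) (y, z) ∧ τ y = min h (l + k * (κ - δ)) + δ ∧
      ρ z = min h (l + k * (κ - δ)) ∧ ∀ t ∈ Icc z z₁, min h (l + k * (κ - δ)) ≤ ρ t := by
    intro k
    induction k with
    | zero =>
      obtain ⟨z, hz, hzl, hlast⟩ := exists_last_hit_up hρ hzm.2 hρm.le (hρ₁ ▸ hlh)
      have hmin : min h (l + (0 : ℕ) * (κ - δ)) = l := by simpa using hlh
      rw [hmin]
      refine ⟨y₀, ⟨le_rfl, hy⟩, z, ⟨hzm.1.trans hz.1, hz.2⟩,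
        freePath_vertical (hzm.1.trans hz.1) (fun b hb => ?_), hτ₀, hzl, hlast⟩
      have := hband b ⟨hb.1, hb.2.trans hz.2⟩
      rw [hτ₀, abs_le]
      constructor <;> linarith
    | succ k ih =>
      obtain ⟨y, hyy, z, hzz, hpath, hτy, hρz, hge⟩ := ih
      set a := min h (l + k * (κ - δ)) with ha
      set a' := min h (l + (k + 1 : ℕ) * (κ - δ)) with ha'
      have hla : l ≤ a := le_min hlh (by nlinarith [(Nat.cast_nonneg k : (0 : ℝ) ≤ k)])
      have haa' : a ≤ a' := by
        refine min_le_min le_rfl ?_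
        push_cast
        nlinarith
      have ha'h : a' ≤ h := min_le_left _ _
      have ha'a : a' ≤ a + (κ - δ) := by
        rw [ha, ← min_add_add_right]
        refine min_le_min (by linarith) ?_
        push_cast
        linarith
      obtain ⟨z', hz', hρz', hge'⟩ := exists_last_hit_up hρ hzz.2 (hρz.le.trans haa')
        (hρ₁ ▸ ha'h)
      obtain ⟨y', hy', hτy', hle'⟩ := exists_first_hit_up hτ (v := a' + δ) hyy.2
        (by rw [hτy]; linarith) (by rw [hτ₁]; linarith)
      refine ⟨y', ⟨hyy.1.trans hy'.1, hy'.2⟩, z', ⟨hzz.1.trans hz'.1, hz'.2⟩,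
        (hpath.trans (freePath_vertical (y' := z') hz'.1 fun b hb => ?_)).trans
          (freePath_horizontal hy'.1 fun t ht => ?_), hτy', hρz', hge'⟩
      · have h1 := hge b ⟨hb.1, hb.2.trans hz'.2⟩
        have h2 := (hband b ⟨hzz.1.trans hb.1, hb.2.trans hz'.2⟩).2
        rw [hτy, abs_le]
        constructor <;> linarith
      · have h1 := hle' t ht
        have h2 := hdrop y t hyy.1 ht.1 (ht.2.trans hy'.2)
        rw [hρz', abs_le]
        constructor <;> linarith
  obtain ⟨k, hk⟩ := exists_nat_gt ((h - l) / (κ - δ))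
  have hk' : min h (l + k * (κ - δ)) = h := by
    rw [div_lt_iff₀ (by linarith)] at hk
    exact min_eq_left (by linarith)
  obtain ⟨y, hyy, z, hzz, hpath, hτy, hρz, hge⟩ := level k
  rw [hk'] at hτy hρz hge
  refine (hpath.trans (freePath_vertical (y' := z₁) hzz.2 fun b hb => ?_)).trans
    (freePath_horizontal hyy.2 fun t ht => ?_)
  · have h1 := hge b hb
    have h2 := (hband b ⟨hzz.1.trans hb.1, hb.2⟩).2
    rw [hτy, abs_le]
    constructor <;> linarith
  · have h1 := hmax t ⟨hyy.1.trans ht.1, ht.2⟩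
    have h2 := hdrop y t hyy.1 ht.1 ht.2
    rw [hρ₁, abs_le]
    constructor <;> linarith

/-- Removing a local maximum of `π` near an ascending edge `[e, e']` of the signature of `τ`.
The curve `ρ` arises from `π` by cutting off its part on `[a, c]` at the height of the higher
endpoint. -/
lemma freePath_ascending {τ π ρ : ℝ → ℝ} (hτ : Continuous τ) (hπ : Continuous π)
    (hρ : Continuous ρ) {δ κ a b c e e' : ℝ} (hκ : δ < κ)
    (ha : 0 ≤ a) (hab : a ≤ b) (hbc : b ≤ c) (hce' : c ≤ e') (he' : e' ≤ 1) (he : 0 ≤ e)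
    (heb : e ≤ b) (hclose : ∀ t ∈ Icc (0 : ℝ) 1, |τ t - π t| ≤ δ)
    (hup : MonotoneOn π (Icc a b)) (hdown : AntitoneOn π (Icc b c))
    (hout : ∀ t ∈ Icc (0 : ℝ) 1, t ≤ a ∨ c ≤ t → ρ t = π t)
    (hin : ∀ t ∈ Icc a c, ρ t = min (π t) (max (π a) (π c)))
    (hπe' : π b ≤ π e')
    (hdrop : ∀ s t, e ≤ s → s ≤ t → t ≤ e' → τ s - τ t ≤ 2 * δ)
    (hlow : ∀ t ∈ Icc b e', τ e ≤ τ t)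
    (hleft : a < e → (∀ y ∈ Icc a e, τ y ≤ max (π a) (π c) + δ) ∨
      ∃ d ∈ Icc 0 a, π e ≤ π d ∧ ∀ t ∈ Icc d e, τ e ≤ τ t) :
    FreePath κ τ ρ (0, 0) (1, 1) := by
  have hc1 : c ≤ 1 := hce'.trans he'
  have hac : a ≤ c := hab.trans hbc
  have hπb : π c ≤ π b := hdown ⟨le_rfl, hbc⟩ ⟨hbc, le_rfl⟩ hbc
  have hπab : π a ≤ π b := hup ⟨le_rfl, hab⟩ ⟨hab, le_rfl⟩ hab
  have close : ∀ t, 0 ≤ t → t ≤ 1 → τ t ≤ π t + δ ∧ π t - δ ≤ τ t := fun t h0 h1 => by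
    have := abs_le.1 (hclose t ⟨h0, h1⟩)
    constructor <;> linarith
  have unimodal : ∀ s t r, a ≤ s → s ≤ t → t ≤ r → r ≤ c → min (π s) (π r) ≤ π t := by
    intro s t r h1 h2 h3 h4
    rcases le_total t b with h | h
    · exact (min_le_left _ _).trans (hup ⟨h1, h2.trans h⟩ ⟨h1.trans h2, h⟩ h2)
    · exact (min_le_right _ _).trans (hdown ⟨h, h3.trans h4⟩ ⟨h.trans h3, h4⟩ h3)
  set q := max (π a) (π c) with hq
  have hπaq : π a ≤ q := le_max_left _ _
  have hπcq : π c ≤ q := le_max_right _ _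
  have diag : ∀ s t, 0 ≤ s → s ≤ t → t ≤ 1 → (∀ y, s ≤ y → y ≤ t → y ∈ Icc a c → τ y ≤ q + δ) →
      FreePath κ τ ρ (s, s) (t, t) := by
    intro s t hs hst ht hy
    refine freePath_diagonal hst fun y hyst => ?_
    have h01 : y ∈ Icc (0 : ℝ) 1 := ⟨hs.trans hyst.1, hyst.2.trans ht⟩
    by_cases hyac : y ∈ Icc a c
    · have h1 := hy y hyst.1 hyst.2 hyac
      have h2 := close y h01.1 h01.2
      rw [hin y hyac, abs_le]
      rcases min_choice (π y) q with h | h <;> rw [h]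
      · constructor <;> linarith
      · have := min_eq_right_iff.1 h
        constructor <;> linarith
    · rw [hout y h01]
      · exact (hclose y h01).trans hκ.le
      · by_contra! hcon
        exact hyac ⟨hcon.1.le, hcon.2.le⟩
  have diag_left : ∀ s t, 0 ≤ s → s ≤ t → t ≤ a → FreePath κ τ ρ (s, s) (t, t) := by
    intro s t hs hst hta
    refine diag s t hs hst (by linarith) fun y h1 h2 h3 => ?_
    have : y = a := le_antisymm (h2.trans hta) h3.1
    subst this
    linarith [close y (hs.trans h1) (by linarith)]
  have diag_right : ∀ s, c ≤ s → s ≤ 1 → FreePath κ τ ρ (s, s) (1, 1) := by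
    intro s hcs hs1
    refine diag s 1 (by linarith) hs1 le_rfl fun y h1 h2 h3 => ?_
    have : y = c := le_antisymm h3.2 (hcs.trans h1)
    subst this
    linarith [close y (by linarith) h2]
  -- The left side.
  obtain ⟨f, hf, hfb, haf, hef, hpath⟩ : ∃ f, (f = a ∨ f = e) ∧ f ≤ b ∧ a ≤ f ∧ e ≤ f ∧
      FreePath κ τ ρ (0, 0) (f, f) := by
    rcases le_or_gt e a with hea | hae
    · exact ⟨a, Or.inl rfl, hab, le_rfl, hea, diag_left 0 a le_rfl ha le_rfl⟩
    refine ⟨e, Or.inr rfl, heb, hae.le, le_rfl, ?_⟩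
    by_cases hno : ∀ y ∈ Icc a e, τ y ≤ q + δ
    · exact diag 0 e le_rfl he (by linarith) fun y _ h2 h3 => hno y ⟨h3.1, h2⟩
    obtain ⟨d, hd, hπd, hτd⟩ := (hleft hae).resolve_left hno
    push Not at hno
    obtain ⟨y₁, hy₁, hy₁q⟩ := hno
    obtain ⟨y₀, hy₀, hmax⟩ := isCompact_Icc.exists_isMaxOn (nonempty_Icc.2 hae.le)
      hτ.continuousOn
    have hmax' : ∀ t ∈ Icc a e, τ t ≤ τ y₀ := fun t ht => hmax ht
    have hM : q + δ < τ y₀ := hy₁q.trans_le (hmax' y₁ hy₁)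
    have hπy₀ : π y₀ ≤ π e := hup ⟨hy₀.1, hy₀.2.trans heb⟩ ⟨hae.le, heb⟩ hy₀.2
    have hcy₀ := close y₀ (ha.trans hy₀.1) (by linarith [hy₀.2])
    have hce := close e he (by linarith)
    obtain ⟨C, hC, hπC, hlast⟩ := exists_last_hit_down hπ (v := τ y₀ - δ) hd.2
      (by linarith) (by linarith)
    have h0C : 0 ≤ C := hd.1.trans hC.1
    refine ((diag_left 0 C le_rfl h0C hC.2).trans
      (freePath_horizontal (x' := e) (hC.2.trans hae.le) fun t ht => ?_)).trans
      (freePath_vertical (hC.2.trans hae.le) fun t ht => ?_)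
    · rw [hout C ⟨h0C, by linarith [hC.2]⟩ (Or.inl hC.2), hπC, abs_le]
      have h1 := hτd t ⟨hC.1.trans ht.1, ht.2⟩
      have h2 : τ t ≤ τ y₀ := by
        rcases le_total t a with hta | hat
        · linarith [hlast t ⟨ht.1, hta⟩, close t (h0C.trans ht.1) (by linarith)]
        · exact hmax' t ⟨hat, ht.2⟩
      constructor <;> linarith
    · have h1 := hτd t ⟨hC.1.trans ht.1, ht.2⟩
      have h2 := close t (h0C.trans ht.1) (by linarith [ht.2])
      have h3 := hτd a ⟨hd.2, hae.le⟩
      have h4 := close a ha (by linarith)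
      rw [abs_le]
      rcases le_total t a with hta | hat
      · rw [hout t ⟨h0C.trans ht.1, by linarith [ht.2]⟩ (Or.inl hta)]
        have := hlast t ⟨ht.1, hta⟩
        constructor <;> linarith
      · rw [hin t ⟨hat, by linarith [ht.2]⟩]
        rcases min_choice (π t) q with h | h <;> rw [h]
        · have := min_eq_left_iff.1 h
          constructor <;> linarith
        · constructor <;> linarith
  -- The right side.
  have hfc : f ≤ c := hfb.trans hbc
  have h0f : 0 ≤ f := ha.trans haf
  by_cases hno : ∀ y ∈ Icc f c, τ y ≤ q + δ
  · exact (hpath.trans (diag f c h0f hfc hc1 fun y h1 h2 _ => hno y ⟨h1, h2⟩)).trans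
      (diag_right c le_rfl hc1)
  push Not at hno
  obtain ⟨y₁, hy₁, hy₁q⟩ := hno
  obtain ⟨y₀, hy₀, hmax⟩ := isCompact_Icc.exists_isMaxOn (nonempty_Icc.2 hfc) hτ.continuousOn
  have hmax' : ∀ t ∈ Icc f c, τ t ≤ τ y₀ := fun t ht => hmax ht
  have hM : q + δ < τ y₀ := hy₁q.trans_le (hmax' y₁ hy₁)
  obtain ⟨h, hh⟩ : ∃ h, τ y₀ = h + δ := ⟨τ y₀ - δ, by ring⟩
  have hqh : q < h := by linarith
  have hπy₀ : h ≤ π y₀ := by linarith [close y₀ (h0f.trans hy₀.1) (hy₀.2.trans hc1)]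
  have hhb : h ≤ π b := by
    refine hπy₀.trans ?_
    rcases le_total y₀ b with hyb | hyb
    · exact hup ⟨haf.trans hy₀.1, hyb⟩ ⟨hab, le_rfl⟩ hyb
    · exact hdown ⟨le_rfl, hbc⟩ ⟨hyb, hy₀.2⟩ hyb
  obtain ⟨C, hC, hπC, hfirst⟩ := exists_first_hit_up hπ (v := h) hce' (by linarith) (by linarith)
  have hC1 : C ≤ 1 := hC.2.trans he'
  obtain ⟨m, hm, hmin⟩ := isCompact_Icc.exists_isMinOn (nonempty_Icc.2 hC.1) hπ.continuousOn
  have hmin' : ∀ t ∈ Icc c C, π m ≤ π t := fun t ht => hmin ht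
  have hmc : π m ≤ π c := hmin' c ⟨le_rfl, hC.1⟩
  have hclosem := close m (by linarith [hm.1]) (by linarith [hm.2])
  have hτem : τ e ≤ π m + δ := by linarith [hlow m ⟨hbc.trans hm.1, hm.2.trans hC.2⟩]
  have hhm : h ≤ π m + 2 * δ := by
    linarith [hdrop y₀ m (hef.trans hy₀.1) (hy₀.2.trans hm.1) (hm.2.trans hC.2)]
  have hρC : ∀ t ∈ Icc c C, ρ t = π t := fun t ht =>
    hout t ⟨by linarith [ht.1], ht.2.trans hC1⟩ (Or.inr ht.1)
  have hτC : ∀ t ∈ Icc y₀ C, h - δ ≤ τ t ∧ τ t ≤ h + δ := by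
    intro t ht
    refine ⟨by linarith [hdrop y₀ t (hef.trans hy₀.1) ht.1 (ht.2.trans hC.2)], ?_⟩
    rcases le_total t c with htc | htc
    · exact (hmax' t ⟨hy₀.1.trans ht.1, htc⟩).trans hh.le
    · linarith [hfirst t ⟨htc, ht.2⟩, close t (by linarith) (ht.2.trans hC1)]
  have bandC : ∀ z₀, (∀ z ∈ Icc z₀ c, π m ≤ ρ z ∧ ρ z ≤ h) →
      ∀ z ∈ Icc z₀ C, π m ≤ ρ z ∧ ρ z ≤ h := by
    intro z₀ hz₀ z hz
    rcases le_total z c with hzc | hzc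
    · exact hz₀ z ⟨hz.1, hzc⟩
    · rw [hρC z ⟨hzc, hz.2⟩]
      exact ⟨hmin' z ⟨hzc, hz.2⟩, hfirst z ⟨hzc, hz.2⟩⟩
  have band : ∀ s, a ≤ s → π m ≤ π s → ∀ z ∈ Icc s c, π m ≤ ρ z ∧ ρ z ≤ h := by
    intro s has hms z hz
    rw [hin z ⟨has.trans hz.1, hz.2⟩]
    exact ⟨le_min ((le_min hms hmc).trans (unimodal s z c has hz.1 hz.2 le_rfl))
      (hmc.trans hπcq), (min_le_right _ _).trans hqh.le⟩
  have finish : ∀ y z, FreePath κ τ ρ (0, 0) (y, z) → e ≤ y → y ≤ y₀ → z ≤ c →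
      τ y = π m + δ → (∀ r ∈ Icc z c, π m ≤ ρ r ∧ ρ r ≤ h) → (∀ t ∈ Icc y y₀, τ t ≤ h + δ) →
      FreePath κ τ ρ (0, 0) (1, 1) := by
    intro y z hyz hey hyy₀ hzc hτy hb hmy
    refine ((hyz.trans (freePath_climb hτ hρ hκ hyy₀ hτy hh hmy
      (fun s t h1 h2 h3 => hdrop s t (hey.trans h1) h2 (by linarith [hy₀.2])) (bandC z hb) hhm
      ⟨hzc.trans hm.1, hm.2⟩ (hρC m hm) ((hρC C ⟨hC.1, le_rfl⟩).trans hπC))).trans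
      (freePath_horizontal (hy₀.2.trans hC.1) fun t ht => ?_)).trans (diag_right C hC.1 hC1)
    rw [hρC C ⟨hC.1, le_rfl⟩, hπC, abs_le]
    have := hτC t ht
    constructor <;> linarith
  have start : ∀ s, FreePath κ τ ρ (0, 0) (s, s) → f ≤ s → s ≤ y₀ → π m ≤ ρ s →
      τ s ≤ π m + δ → FreePath κ τ ρ (0, 0) (1, 1) := by
    intro s hs hfs hsy₀ hms hτs
    have hsc : s ≤ c := hsy₀.trans hy₀.2
    have hρs := hin s ⟨haf.trans hfs, hsc⟩
    have hρsπ : ρ s ≤ π s := hρs ▸ min_le_left _ _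
    have hρsq : ρ s ≤ q := hρs ▸ min_le_right _ _
    obtain ⟨y, hy, hτy, hle⟩ := exists_first_hit_up hτ (v := π m + δ) hsy₀ hτs (by linarith)
    refine finish y s (hs.trans (freePath_horizontal hy.1 fun t ht => ?_))
      (hef.trans (hfs.trans hy.1)) hy.2 hsc hτy
      (band s (haf.trans hfs) (hms.trans hρsπ))
      fun t ht => (hmax' t ⟨hfs.trans (hy.1.trans ht.1), ht.2.trans hy₀.2⟩).trans hh.le
    have h1 := hle t ht
    have h2 := unimodal s t y₀ (haf.trans hfs) ht.1 (ht.2.trans hy.2) hy₀.2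
    have h3 : ρ s ≤ min (π s) (π y₀) := le_min hρsπ (by linarith)
    have h4 := close t (by linarith [ht.1]) (by linarith [ht.2, hy.2, hy₀.2])
    rw [abs_le]
    constructor <;> linarith
  rcases le_or_gt (π f) (π m) with hfm | hmf
  · obtain ⟨s, hs, hπs, hles⟩ := exists_first_hit_up hπ (v := π m) hfb hfm (by linarith)
    have hsc : s ≤ c := hs.2.trans hbc
    refine start s (hpath.trans (diag f s h0f hs.1 (hsc.trans hc1) fun y h1 h2 _ => ?_)) hs.1 ?_
      ?_ ?_
    · linarith [hles y ⟨h1, h2⟩, close y (h0f.trans h1) (h2.trans (hsc.trans hc1))]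
    · by_contra! hlt
      linarith [hles y₀ ⟨hy₀.1, hlt.le⟩]
    · rw [hin s ⟨haf.trans hs.1, hsc⟩, hπs]
      exact le_min le_rfl (hmc.trans hπcq)
    · linarith [close s (h0f.trans hs.1) (hsc.trans hc1)]
  rcases le_or_gt (τ f) (π m + δ) with hτf | hτf
  · refine start f hpath le_rfl hy₀.1 ?_ hτf
    rw [hin f ⟨haf, hfc⟩]
    exact le_min hmf.le (hmc.trans hπcq)
  have hfa : f = a := by
    rcases hf with hf | hf
    · exact hf
    · rw [hf] at hτf
      linarith
  subst hfa
  obtain ⟨s, hs, hτs, hges⟩ := exists_last_hit_up hτ hef hτem hτf.le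
  have h0s : 0 ≤ s := he.trans hs.1
  have hρs : ∀ t ∈ Icc s f, ρ t = π t ∧ π m ≤ π t := by
    intro t ht
    have h1 : t ∈ Icc (0 : ℝ) 1 := ⟨h0s.trans ht.1, by linarith [ht.2]⟩
    exact ⟨hout t h1 (Or.inl ht.2), by linarith [hges t ht, close t h1.1 h1.2]⟩
  have band' : ∀ r ∈ Icc s f, (∀ t ∈ Icc r f, π t ≤ h) →
      ∀ z ∈ Icc r c, π m ≤ ρ z ∧ ρ z ≤ h := by
    intro r hr hrh z hz
    rcases le_total z f with hzf | hzf
    · rw [(hρs z ⟨hr.1.trans hz.1, hzf⟩).1]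
      exact ⟨(hρs z ⟨hr.1.trans hz.1, hzf⟩).2, hrh z ⟨hz.1, hzf⟩⟩
    · exact band f le_rfl hmf.le z ⟨hzf, hz.2⟩
  have hτle : ∀ r ∈ Icc s f, (∀ t ∈ Icc r f, π t ≤ h) → ∀ z ∈ Icc r C, τ z ≤ h + δ := by
    intro r hr hrh z hz
    rcases le_total z f with hzf | hzf
    · linarith [hrh z ⟨hz.1, hzf⟩, close z (by linarith [hr.1, hz.1]) (by linarith)]
    rcases le_total z y₀ with hzy | hzy
    · exact (hmax' z ⟨hzf, hzy.trans hy₀.2⟩).trans hh.le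
    · exact (hτC z ⟨hzy, hz.2⟩).2
  by_cases hall : ∀ t ∈ Icc s f, π t ≤ h
  · exact finish s s (diag_left 0 s le_rfl h0s hs.2) hs.1 (hs.2.trans hy₀.1) (hs.2.trans hfc)
      hτs (band' s ⟨le_rfl, hs.2⟩ hall) fun t ht =>
        hτle s ⟨le_rfl, hs.2⟩ hall t ⟨ht.1, by linarith [ht.2, hy₀.2, hC.1]⟩
  push Not at hall
  obtain ⟨t₀, ht₀, hπt₀⟩ := hall
  obtain ⟨r, hr, hπr, hler⟩ := exists_last_hit_down hπ ht₀.2 hπt₀.le (hπaq.trans hqh.le)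
  have hrs : r ∈ Icc s f := ⟨ht₀.1.trans hr.1, hr.2⟩
  have h0r : 0 ≤ r := h0s.trans hrs.1
  have hfm' : f ≤ m := hfc.trans hm.1
  obtain ⟨y, hy, hτy, hgey⟩ := exists_first_hit_down hτ hfm' hτf.le (by linarith)
  have hry : r ≤ y := hr.2.trans hy.1
  have hyC : y ≤ C := hy.2.trans hm.2
  have hpathy : FreePath κ τ ρ (0, 0) (y, r) := by
    refine (diag_left 0 r le_rfl h0r hr.2).trans (freePath_horizontal hry fun t ht => ?_)
    have h1 := hτle r hrs hler t ⟨ht.1, ht.2.trans hyC⟩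
    have h2 : π m + δ ≤ τ t := by
      rcases le_total t f with htf | htf
      · exact hges t ⟨hrs.1.trans ht.1, htf⟩
      · exact hgey t ⟨htf, ht.2⟩
    rw [(hρs r hrs).1, hπr, abs_le]
    constructor <;> linarith
  rcases le_total y y₀ with hyy₀ | hyy₀
  · exact finish y r hpathy (hef.trans hy.1) hyy₀ (hr.2.trans hfc) hτy (band' r hrs hler)
      fun t ht => hτle r hrs hler t ⟨hry.trans ht.1, by linarith [ht.2, hy₀.2, hC.1]⟩
  · refine ((hpathy.trans (freePath_vertical (hry.trans hyC) fun z hz => ?_)).trans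
      (freePath_horizontal hyC fun t ht => ?_)).trans (diag_right C hC.1 hC1)
    · have := bandC r (band' r hrs hler) z hz
      rw [hτy, abs_le]
      constructor <;> linarith
    · rw [hρC C ⟨hC.1, le_rfl⟩, hπC, abs_le]
      have := hτC t ⟨hyy₀.trans ht.1, ht.2⟩
      constructor <;> linarith

lemma IsSignature.neg {δ : ℝ} {τ : ℝ → ℝ} {l : ℕ} {s : ℕ → ℝ} (h : IsSignature δ τ l s) :
    IsSignature δ (fun x => -τ x) l s := by
  obtain ⟨h1, h2, h3, h4, h5, h6, h7, h8, h9, h10, h11, h12, h13⟩ := h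
  have hu : ∀ x y z : ℝ, -x ∈ uIcc (-y) (-z) ↔ x ∈ uIcc y z := by
    intro x y z
    simp only [mem_uIcc, neg_le_neg_iff]
    tauto
  have hI : ∀ x y : ℝ, x ∈ Icc (y - δ) (y + δ) → -x ∈ Icc (-y - δ) (-y + δ) := by
    rintro x y ⟨hx, hy⟩
    constructor <;> linarith
  refine ⟨h1, h2, h3, h4, fun i hi hi' => by simpa only [hu] using h5 i hi hi',
    fun i hi a b ha hab hb => ⟨fun hlt => ?_, fun hlt => ?_⟩, fun i hi hi' => ?_, ?_, ?_,
    fun i hi hi' a ha => by simpa only [hu] using h10 i hi hi' a ha,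
    fun hl a ha => ?_, fun hl a ha => ?_, fun hl a ha => ?_⟩
  · linarith [(h6 i hi a b ha hab hb).2 (neg_lt_neg_iff.1 hlt)]
  · linarith [(h6 i hi a b ha hab hb).1 (neg_lt_neg_iff.1 hlt)]
  · rw [← abs_neg]
    convert h7 i hi hi' using 2
    ring
  · rw [← abs_neg]
    convert h8 using 2
    ring
  · rw [← abs_neg]
    convert h9 using 2
    ring
  · exact (h11 hl a ha).imp (hu _ _ _).2 (hI _ _)
  · exact (h12 hl a ha).imp (hu _ _ _).2 (hI _ _)
  · exact (h13 hl a ha).imp (Or.imp (hu _ _ _).2 (hI _ _)) (hI _ _)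

lemma IsSignature.reverse {δ : ℝ} {τ : ℝ → ℝ} {l : ℕ} {s : ℕ → ℝ} (h : IsSignature δ τ l s) :
    IsSignature δ (fun x => τ (1 - x)) l (fun i => 1 - s (l - 1 - i)) := by
  obtain ⟨h1, h2, h3, h4, h5, h6, h7, h8, h9, h10, h11, h12, h13⟩ := h
  have hs : ∀ x : ℝ, 1 - (1 - x) = x := sub_sub_cancel 1
  have hIcc : ∀ x y a : ℝ, a ∈ Icc (1 - y) (1 - x) → 1 - a ∈ Icc x y := by
    rintro x y a ⟨hx, hy⟩
    constructor <;> linarith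
  have e0 : l - 1 - 0 = l - 1 := rfl
  have e1 : l - 1 - 1 = l - 2 := rfl
  have e2 : l - 1 - (l - 1) = 0 := Nat.sub_self _
  have e3 : l - 1 - (l - 2) = 1 := by omega
  have hstep : ∀ i, i + 1 < l → ∃ k, k + 1 < l ∧ l - 1 - i = k + 1 ∧ l - 1 - (i + 1) = k :=
    fun i hi => ⟨l - 1 - (i + 1), by omega, by omega, rfl⟩
  simp only [IsSignature, hs, e0, e1, e2, e3]
  refine ⟨h1, by rw [h3]; norm_num, by rw [h2]; norm_num, fun i hi => ?_, fun i hi hi' => ?_,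
    fun i hi a b ha hab hb => ?_, fun i hi hi' => ?_, by rwa [abs_sub_comm],
    by rwa [abs_sub_comm], fun i hi hi' a ha => ?_, fun hl a ha => ?_, fun hl a ha => ?_,
    fun hl a ha => ?_⟩
  · obtain ⟨k, hk, e, e'⟩ := hstep i hi
    rw [e, e']
    linarith [h4 k hk]
  · rw [uIcc_comm]
    have := h5 (l - 1 - i) (by omega) (by omega)
    rwa [show l - 1 - i - 1 = l - 1 - (i + 1) by omega,
      show l - 1 - i + 1 = l - 1 - (i - 1) by omega] at this
  · obtain ⟨k, hk, e, e'⟩ := hstep i hi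
    simp only [e, e'] at ha hb ⊢
    exact (h6 k hk (1 - b) (1 - a) (by linarith) (by linarith) (by linarith)).symm
  · obtain ⟨k, hk, e, e'⟩ := hstep i (by omega)
    rw [e, e', abs_sub_comm]
    exact h7 k (by omega) (by omega)
  · obtain ⟨k, hk, e, e'⟩ := hstep i (by omega)
    simp only [e, e'] at ha ⊢
    rw [uIcc_comm]
    exact h10 k (by omega) (by omega) _ (hIcc _ _ _ ha)
  · rw [uIcc_comm]
    exact h12 hl _ (hIcc _ _ _ ha)
  · rw [uIcc_comm]
    exact h11 hl _ (hIcc _ _ _ ha)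
  · subst hl
    rw [uIcc_comm, union_right_comm]
    exact h13 rfl _ (hIcc _ _ _ ha)

lemma IsSignature.edge_length {δ : ℝ} (hδ : 0 ≤ δ) {τ : ℝ → ℝ} {l : ℕ} {s : ℕ → ℝ}
    (h : IsSignature δ τ l s) {j : ℕ} (hj : j + 1 < l) : δ < |τ (s (j + 1)) - τ (s j)| := by
  obtain ⟨h1, h2, h3, h4, h5, h6, h7, h8, h9, -⟩ := h
  rcases Nat.eq_zero_or_pos j with rfl | hj0
  · exact h8
  rcases Nat.lt_or_ge (j + 2) l with hl | hl
  · linarith [h7 j hj0 hl]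
  · obtain rfl : l = j + 2 := by omega
    exact h9

lemma IsSignature.range_of_lt {δ : ℝ} (hδ : 0 ≤ δ) {τ : ℝ → ℝ} {l : ℕ} {s : ℕ → ℝ}
    (h : IsSignature δ τ l s) {j : ℕ} (hj : j + 1 < l) (hlt : τ (s j) < τ (s (j + 1)))
    {x : ℝ} (hx : x ∈ Icc (s j) (s (j + 1))) :
    (1 ≤ j → τ (s j) ≤ τ x) ∧ τ (s j) - δ ≤ τ x ∧
      (j + 2 < l → τ x ≤ τ (s (j + 1))) ∧ τ x ≤ τ (s (j + 1)) + δ := by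
  have hlen := h.edge_length hδ hj
  rw [abs_of_pos (sub_pos.2 hlt)] at hlen
  obtain ⟨h1, h2, h3, h4, h5, h6, h7, h8, h9, h10, h11, h12, h13⟩ := h
  rcases Nat.lt_or_ge (j + 2) l with hl | hl <;> rcases Nat.eq_zero_or_pos j with rfl | hj0
  · rcases h11 hl x hx with hx | hx
    · rw [uIcc_of_le hlt.le] at hx
      exact ⟨fun _ => hx.1, by linarith [hx.1], fun _ => hx.2, by linarith [hx.2]⟩
    · exact ⟨fun h => absurd h (by omega), hx.1, fun _ => by linarith [hx.2], by linarith [hx.2]⟩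
  · have hx := h10 j hj0 hl x hx
    rw [uIcc_of_le hlt.le] at hx
    exact ⟨fun _ => hx.1, by linarith [hx.1], fun _ => hx.2, by linarith [hx.2]⟩
  · rcases h13 (by omega) x hx with (hx | hx) | hx
    · rw [uIcc_of_le hlt.le] at hx
      exact ⟨fun _ => hx.1, by linarith [hx.1], fun _ => hx.2, by linarith [hx.2]⟩
    · exact ⟨fun h => absurd h (by omega), hx.1, fun h => absurd h (by omega), by linarith [hx.2]⟩
    · exact ⟨fun h => absurd h (by omega), by linarith [hx.1], fun h => absurd h (by omega), hx.2⟩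
  · obtain rfl : l = j + 2 := by omega
    rcases h12 (by omega) x hx with hx | hx
    · simp only [Nat.add_sub_cancel, show j + 2 - 1 = j + 1 from rfl] at hx
      rw [uIcc_of_le hlt.le] at hx
      exact ⟨fun _ => hx.1, by linarith [hx.1], fun _ => hx.2, by linarith [hx.2]⟩
    · simp only [show j + 2 - 1 = j + 1 from rfl] at hx
      exact ⟨fun _ => by linarith [hx.1], by linarith [hx.1], fun h => absurd h (by omega), hx.2⟩

/-- Cutting off a local maximum of `π` that lies outside all ranges of the signature, where the
maximum is matched to an ascending edge of the signature. -/
lemma freePath_of_ascending_edge {τ π ρ : ℝ → ℝ} (hτ : Continuous τ) (hπ : Continuous π)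
    (hρ : Continuous ρ) {δ κ a b c : ℝ} {l : ℕ} {s : ℕ → ℝ} (hδ : 0 ≤ δ) (hκ : δ < κ)
    (hsig : IsSignature δ τ l s)
    (ha : 0 ≤ a) (hab : a ≤ b) (hbc : b ≤ c) (hc : c ≤ 1)
    (hclose : ∀ t ∈ Icc (0 : ℝ) 1, |τ t - π t| ≤ δ)
    (hup : MonotoneOn π (Icc a b)) (hdown : AntitoneOn π (Icc b c))
    (hout : ∀ t ∈ Icc (0 : ℝ) 1, t ≤ a ∨ c ≤ t → ρ t = π t)
    (hin : ∀ t ∈ Icc a c, ρ t = min (π t) (max (π a) (π c)))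
    (hint : ∀ j, 1 ≤ j → j + 1 < l → π b ∉ Icc (τ (s j) - δ) (τ (s j) + δ))
    (hend₀ : π b ∉ Icc (τ (s 0) - 4 * δ) (τ (s 0) + 4 * δ))
    (hend₁ : π b ∉ Icc (τ (s (l - 1)) - 4 * δ) (τ (s (l - 1)) + 4 * δ))
    {j : ℕ} (hj : j + 1 < l) (hb : b ∈ Icc (s j) (s (j + 1)))
    (hlt : τ (s j) < τ (s (j + 1))) : FreePath κ τ ρ (0, 0) (1, 1) := by
  have hlen := fun i (hi : i + 1 < l) => hsig.edge_length hδ hi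
  have hrange := fun x hx => hsig.range_of_lt hδ hj hlt (x := x) hx
  have hsig' := hsig
  obtain ⟨-, hs0, hs1, hs, hnondeg, hdir, hlen', -⟩ := hsig'
  have hmono : ∀ i k, i ≤ k → k < l → s i ≤ s k := by
    intro i k hik
    induction k, hik using Nat.le_induction with
    | base => exact fun _ => le_rfl
    | succ k _ ih => exact fun hk => (ih (by omega)).trans (hs k hk).le
  have hpos : ∀ i, i < l → 0 ≤ s i := fun i hi => hs0 ▸ hmono 0 i (Nat.zero_le i) hi
  have hle1 : ∀ i, i < l → s i ≤ 1 := fun i hi => hs1 ▸ hmono i (l - 1) (by omega) (by omega)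
  have close : ∀ t, 0 ≤ t → t ≤ 1 → τ t ≤ π t + δ ∧ π t - δ ≤ τ t := fun t h0 h1 => by
    have := abs_le.1 (hclose t ⟨h0, h1⟩)
    constructor <;> linarith
  have hb0 := ha.trans hab
  have hb1 := hbc.trans hc
  have hcb := close b hb0 hb1
  have hcs := fun i hi => close (s i) (hpos i hi) (hle1 i hi)
  have hdrop : ∀ x y, s j ≤ x → x ≤ y → y ≤ s (j + 1) → τ x - τ y ≤ 2 * δ := by
    intro x y hx hxy hy
    rcases hxy.eq_or_lt with rfl | hxy
    · linarith
    · exact (hdir j hj x y hx hxy hy).1 hlt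
  have hlenj := hlen j hj
  rw [abs_of_pos (sub_pos.2 hlt)] at hlenj
  have hupper : π b < τ (s (j + 1)) - δ := by
    rcases Nat.lt_or_ge (j + 2) l with hl | hl
    · have h1 := (hrange b hb).2.2.1 hl
      by_contra! hcon
      exact hint (j + 1) (by omega) (by omega) ⟨hcon, by linarith⟩
    · obtain rfl : l = j + 2 := by omega
      have h1 := (hrange b hb).2.2.2
      by_contra! hcon
      exact hend₁ ⟨by simp only [show j + 2 - 1 = j + 1 from rfl]; linarith,
        by simp only [show j + 2 - 1 = j + 1 from rfl]; linarith⟩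
  have hπe' : π b < π (s (j + 1)) := by linarith [hcs (j + 1) hj]
  have hce' : c ≤ s (j + 1) := by
    by_contra! hcon
    exact absurd (hdown ⟨le_rfl, hbc⟩ ⟨hb.2, hcon.le⟩ hb.2) (not_le.2 hπe')
  have hlow : ∀ t ∈ Icc b (s (j + 1)), τ (s j) ≤ τ t := by
    intro t ht
    rcases Nat.eq_zero_or_pos j with rfl | hj0
    · have h1 := (hrange b hb).2.1
      have h2 : τ (s 0) + 4 * δ < π b := by
        by_contra! hcon
        exact hend₀ ⟨by linarith, hcon⟩
      linarith [hdrop b t hb.1 ht.1 ht.2]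
    · exact (hrange t ⟨hb.1.trans ht.1, ht.2⟩).1 hj0
  refine freePath_ascending hτ hπ hρ hκ ha hab hbc hce' (hle1 _ hj) (hpos j (by omega)) hb.1
    hclose hup hdown hout hin hπe'.le hdrop hlow fun hae => ?_
  obtain ⟨k, rfl⟩ : ∃ k, j = k + 1 := Nat.exists_eq_succ_of_ne_zero (by
    rintro rfl
    linarith)
  have hdesc : τ (s (k + 1)) < τ (s k) := by
    have h1 := hnondeg (k + 1) (by omega) hj
    by_contra! hcon
    exact h1 (mem_uIcc_of_le hcon hlt.le)
  have hrange' := fun x hx => hsig.neg.range_of_lt hδ (j := k) (by omega) (neg_lt_neg hdesc)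
    (x := x) hx
  simp only [neg_le_neg_iff] at hrange'
  have hlenk := hlen k (by omega)
  rw [abs_of_neg (sub_neg.2 hdesc)] at hlenk
  have hπe : π (s (k + 1)) ≤ π b := hup ⟨hae.le, hb.1⟩ ⟨hab, le_rfl⟩ hb.1
  have hcj := hcs (k + 1) (by omega)
  rcases Nat.eq_zero_or_pos k with rfl | hk0
  · by_cases hbig : τ (s 0) + 4 * δ < π b
    · left
      intro y hy
      have h1 := (hrange' y ⟨by linarith [hy.1], hy.2⟩).2.1
      have h2 := hdrop b c hb.1 hbc hce'
      have h3 := close c (hb0.trans hbc) hc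
      have h4 := le_max_right (π a) (π c)
      linarith
    · right
      refine ⟨0, ⟨le_rfl, ha⟩, ?_, fun t ht => ?_⟩
      · have h1 : π b < τ (s 0) - 4 * δ := by
          by_contra! hcon
          exact hend₀ ⟨hcon, not_lt.1 hbig⟩
        have h2 := hcs 0 (by omega)
        rw [hs0] at h2 h1
        linarith
      · exact (hrange' t ⟨by rw [hs0]; exact ht.1, ht.2⟩).2.2.1 hj
  · right
    have h1 := hlen' k hk0 (by omega)
    rw [abs_of_neg (sub_neg.2 hdesc)] at h1
    have h2 : π (s (k + 1)) < π (s k) := by linarith [hcs k (by omega)]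
    refine ⟨s k, ⟨hpos k (by omega), ?_⟩, h2.le, fun t ht => (hrange' t ht).2.2.1 hj⟩
    by_contra! hcon
    exact absurd (hup ⟨hcon.le, (hs k (by omega)).le.trans hb.1⟩ ⟨hae.le, hb.1⟩
      (hs k (by omega)).le) (not_le.2 h2)

/-- Knots `T 0 ≤ … ≤ T n` cover the interval they span. -/
lemma exists_knot_interval {T : ℕ → ℝ} {x : ℝ} : ∀ {n : ℕ}, 0 < n → T 0 ≤ x → x ≤ T n →
    ∃ k < n, x ∈ Icc (T k) (T (k + 1))
  | 0, h, _, _ => absurd h (lt_irrefl 0)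
  | 1, _, h₀, h₁ => ⟨0, one_pos, h₀, h₁⟩
  | n + 2, _, h₀, h₁ => by
    rcases le_total x (T (n + 1)) with h | h
    · obtain ⟨k, hk, hx⟩ := exists_knot_interval n.succ_pos h₀ h
      exact ⟨k, hk.trans (Nat.lt_succ_self _), hx⟩
    · exact ⟨n + 1, Nat.lt_succ_self _, h, h₁⟩

lemma IsSignature.exists_edge {δ : ℝ} {τ : ℝ → ℝ} {l : ℕ} {s : ℕ → ℝ} (h : IsSignature δ τ l s)
    {x : ℝ} (hx : x ∈ Icc (0 : ℝ) 1) : ∃ j, j + 1 < l ∧ x ∈ Icc (s j) (s (j + 1)) := by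
  obtain ⟨hl, hs0, hs1, -⟩ := h
  obtain ⟨j, hj, hxj⟩ := exists_knot_interval (T := s) (n := l - 1) (by omega) (hs0 ▸ hx.1)
    (hs1 ▸ hx.2)
  exact ⟨j, by omega, hxj⟩

/-- Cutting off a local maximum of `π` that lies outside all ranges of the signature. -/
lemma freePath_of_localMax {τ π ρ : ℝ → ℝ} (hτ : Continuous τ) (hπ : Continuous π)
    (hρ : Continuous ρ) {δ κ a b c : ℝ} {l : ℕ} {s : ℕ → ℝ} (hδ : 0 ≤ δ) (hκ : δ < κ)
    (hsig : IsSignature δ τ l s)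
    (ha : 0 ≤ a) (hab : a ≤ b) (hbc : b ≤ c) (hc : c ≤ 1)
    (hclose : ∀ t ∈ Icc (0 : ℝ) 1, |τ t - π t| ≤ δ)
    (hup : MonotoneOn π (Icc a b)) (hdown : AntitoneOn π (Icc b c))
    (hout : ∀ t ∈ Icc (0 : ℝ) 1, t ≤ a ∨ c ≤ t → ρ t = π t)
    (hin : ∀ t ∈ Icc a c, ρ t = min (π t) (max (π a) (π c)))
    (hint : ∀ j, 1 ≤ j → j + 1 < l → π b ∉ Icc (τ (s j) - δ) (τ (s j) + δ))
    (hend₀ : π b ∉ Icc (τ (s 0) - 4 * δ) (τ (s 0) + 4 * δ))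
    (hend₁ : π b ∉ Icc (τ (s (l - 1)) - 4 * δ) (τ (s (l - 1)) + 4 * δ)) :
    FreePath κ τ ρ (0, 0) (1, 1) := by
  obtain ⟨j, hj, hb⟩ := hsig.exists_edge ⟨ha.trans hab, hbc.trans hc⟩
  have hlen := hsig.edge_length hδ hj
  rcases lt_trichotomy (τ (s j)) (τ (s (j + 1))) with hlt | heq | hgt
  · exact freePath_of_ascending_edge hτ hπ hρ hδ hκ hsig ha hab hbc hc hclose hup hdown hout hin
      hint hend₀ hend₁ hj hb hlt
  · rw [heq, sub_self, abs_zero] at hlen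
    exact absurd hlen (not_lt.2 hδ)
  · have e : l - 1 - (l - 2 - j) = j + 1 := by omega
    have e' : l - 1 - (l - 2 - j + 1) = j := by omega
    have hrev : FreePath κ (fun x => τ (1 - x)) (fun x => ρ (1 - x)) (0, 0) (1, 1) := by
      refine freePath_of_ascending_edge (π := fun x => π (1 - x)) (a := 1 - c) (b := 1 - b)
        (c := 1 - a) (j := l - 2 - j) (by fun_prop) (by fun_prop) (by fun_prop) hδ hκ hsig.reverse
        (by linarith) (by linarith) (by linarith) (by linarith)
        (fun t ht => hclose _ ⟨by linarith [ht.2], by linarith [ht.1]⟩)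
        (fun x hx y hy hxy => hdown ⟨by linarith [hy.2], by linarith [hy.1]⟩
          ⟨by linarith [hx.2], by linarith [hx.1]⟩ (by linarith))
        (fun x hx y hy hxy => hup ⟨by linarith [hy.2], by linarith [hy.1]⟩
          ⟨by linarith [hx.2], by linarith [hx.1]⟩ (by linarith))
        (fun t ht h => hout _ ⟨by linarith [ht.2], by linarith [ht.1]⟩
          (h.symm.imp (fun h => by linarith) (fun h => by linarith)))
        (fun t ht => ?_) (fun k hk hk' => ?_) ?_ ?_ (by omega) ?_ ?_
      · have := hin (1 - t) ⟨by linarith [ht.2], by linarith [ht.1]⟩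
        simpa only [sub_sub_cancel, max_comm] using this
      · simpa only [sub_sub_cancel] using hint (l - 1 - k) (by omega) (by omega)
      · simpa only [sub_sub_cancel, Nat.sub_zero] using hend₁
      · simpa only [sub_sub_cancel, Nat.sub_self] using hend₀
      · rw [e, e']
        exact ⟨by linarith [hb.2], by linarith [hb.1]⟩
      · simpa only [e, e', sub_sub_cancel] using hgt
    simpa using hrev.reverse

lemma min_neg_max_neg (x y z : ℝ) : min (-x) (max (-y) (-z)) = -max x (min y z) := by
  rw [max_neg_neg, min_neg_neg]

/-- Cutting off a vertex of `π` that lies outside all ranges of the signature: the curve `ρ`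
clamps `π` on `[a, c]` to the interval spanned by its values at `a` and `c`. -/
lemma freePath_of_vertex {τ π ρ : ℝ → ℝ} (hτ : Continuous τ) (hπ : Continuous π)
    (hρ : Continuous ρ) {δ κ a b c : ℝ} {l : ℕ} {s : ℕ → ℝ} (hδ : 0 ≤ δ) (hκ : δ < κ)
    (hsig : IsSignature δ τ l s)
    (ha : 0 ≤ a) (hab : a ≤ b) (hbc : b ≤ c) (hc : c ≤ 1)
    (hclose : ∀ t ∈ Icc (0 : ℝ) 1, |τ t - π t| ≤ δ)
    (hab₁ : π a ≤ π b → MonotoneOn π (Icc a b)) (hab₂ : π b ≤ π a → AntitoneOn π (Icc a b))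
    (hbc₁ : π b ≤ π c → MonotoneOn π (Icc b c)) (hbc₂ : π c ≤ π b → AntitoneOn π (Icc b c))
    (hout : ∀ t ∈ Icc (0 : ℝ) 1, t ≤ a ∨ c ≤ t → ρ t = π t)
    (hin : ∀ t ∈ Icc a c, ρ t = max (min (π a) (π c)) (min (π t) (max (π a) (π c))))
    (hint : ∀ j, 1 ≤ j → j + 1 < l → π b ∉ Icc (τ (s j) - δ) (τ (s j) + δ))
    (hend₀ : π b ∉ Icc (τ (s 0) - 4 * δ) (τ (s 0) + 4 * δ))
    (hend₁ : π b ∉ Icc (τ (s (l - 1)) - 4 * δ) (τ (s (l - 1)) + 4 * δ)) :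
    FreePath κ τ ρ (0, 0) (1, 1) := by
  have hnot : ∀ x y r : ℝ, x ∉ Icc (y - r) (y + r) → -x ∉ Icc (-y - r) (-y + r) :=
    fun x y r h hx => h ⟨by linarith [hx.2], by linarith [hx.1]⟩
  have hmem : ∀ t ∈ Icc a c, π t ∈ uIcc (π a) (π b) ∨ π t ∈ uIcc (π b) (π c) := by
    intro t ht
    rcases le_total t b with htb | htb
    · refine Or.inl ?_
      rcases le_total (π a) (π b) with h | h
      · exact mem_uIcc_of_le (hab₁ h ⟨le_rfl, hab⟩ ⟨ht.1, htb⟩ ht.1)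
          (hab₁ h ⟨ht.1, htb⟩ ⟨hab, le_rfl⟩ htb)
      · exact mem_uIcc_of_ge (hab₂ h ⟨ht.1, htb⟩ ⟨hab, le_rfl⟩ htb)
          (hab₂ h ⟨le_rfl, hab⟩ ⟨ht.1, htb⟩ ht.1)
    · refine Or.inr ?_
      rcases le_total (π b) (π c) with h | h
      · exact mem_uIcc_of_le (hbc₁ h ⟨le_rfl, hbc⟩ ⟨htb, ht.2⟩ htb)
          (hbc₁ h ⟨htb, ht.2⟩ ⟨hbc, le_rfl⟩ ht.2)
      · exact mem_uIcc_of_ge (hbc₂ h ⟨htb, ht.2⟩ ⟨hbc, le_rfl⟩ ht.2)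
          (hbc₂ h ⟨le_rfl, hbc⟩ ⟨htb, ht.2⟩ htb)
  have hle : min (π a) (π c) ≤ π b → ∀ t ∈ Icc a c, min (π a) (π c) ≤ π t := by
    intro h t ht
    rcases hmem t ht with h' | h'
    · exact (le_min (min_le_left _ _) h).trans h'.1
    · exact (le_min h (min_le_right _ _)).trans h'.1
  have hge : π b ≤ max (π a) (π c) → ∀ t ∈ Icc a c, π t ≤ max (π a) (π c) := by
    intro h t ht
    rcases hmem t ht with h' | h'
    · exact h'.2.trans (max_le (le_max_left _ _) h)
    · exact h'.2.trans (max_le h (le_max_right _ _))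
  rcases le_or_gt (max (π a) (π c)) (π b) with hmax | hmax
  · obtain ⟨hba, hbc'⟩ := max_le_iff.1 hmax
    refine freePath_of_localMax hτ hπ hρ hδ hκ hsig ha hab hbc hc hclose (hab₁ hba) (hbc₂ hbc')
      hout (fun t ht => ?_) hint hend₀ hend₁
    rw [hin t ht, max_eq_right]
    exact le_min (hle ((min_le_left _ _).trans hba) t ht) min_le_max
  rcases le_or_gt (π b) (min (π a) (π c)) with hmin | hmin
  · obtain ⟨hba, hbc'⟩ := le_min_iff.1 hmin
    refine FreePath.neg (freePath_of_localMax (π := fun x => -π x) hτ.neg hπ.neg hρ.neg hδ hκ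
      hsig.neg ha hab hbc hc (fun t ht => ?_) (hab₂ hba).neg (hbc₁ hbc').neg
      (fun t ht h => congrArg Neg.neg (hout t ht h)) (fun t ht => ?_)
      (fun j hj hj' => hnot _ _ _ (hint j hj hj')) (hnot _ _ _ hend₀) (hnot _ _ _ hend₁))
    · change |-τ t - -π t| ≤ δ
      rw [neg_sub_neg, abs_sub_comm]
      exact hclose t ht
    · change -ρ t = _
      rw [min_neg_max_neg, hin t ht, max_comm, min_eq_left (hge hmax.le t ht)]
  · refine freePath_diagonal zero_le_one fun t ht => ?_
    suffices ρ t = π t from this ▸ (hclose t ht).trans hκ.le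
    rcases le_total t a with h | h
    · exact hout t ht (Or.inl h)
    rcases le_total c t with h' | h'
    · exact hout t ht (Or.inr h')
    · rw [hin t ⟨h, h'⟩, min_eq_left (hge hmax.le t ⟨h, h'⟩), max_eq_right (hle hmin.le t ⟨h, h'⟩)]

lemma knots_le {n : ℕ} {T : ℕ → ℝ} (hT : ∀ j < n, T j < T (j + 1)) {j k : ℕ} (hjk : j ≤ k)
    (hk : k ≤ n) : T j ≤ T k := by
  induction k, hjk using Nat.le_induction with
  | base => exact le_rfl
  | succ k _ ih => exact (ih (by omega)).trans (hT k (by omega)).le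

/-- The continuous function that is `0` before `a`, `1` after `b` and affine in between. -/
noncomputable def ramp (a b x : ℝ) : ℝ := max 0 (min 1 ((x - a) / (b - a)))

lemma continuous_ramp (a b : ℝ) : Continuous (ramp a b) := by
  unfold ramp
  fun_prop

lemma monotone_ramp {a b : ℝ} (h : a < b) : Monotone (ramp a b) := fun x y hxy => by
  have := sub_pos.2 h
  unfold ramp
  gcongr

lemma ramp_of_le {a b x : ℝ} (h : a < b) (hx : x ≤ a) : ramp a b x = 0 :=
  max_eq_left ((min_le_right _ _).trans
    (div_nonpos_of_nonpos_of_nonneg (sub_nonpos.2 hx) (sub_nonneg.2 h.le)))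

lemma ramp_of_ge {a b x : ℝ} (h : a < b) (hx : b ≤ x) : ramp a b x = 1 := by
  rw [ramp, min_eq_left ((one_le_div (sub_pos.2 h)).2 (by linarith)), max_eq_right zero_le_one]

lemma ramp_of_mem {a b x : ℝ} (h : a < b) (hx : x ∈ Icc a b) :
    ramp a b x = (x - a) / (b - a) := by
  have := sub_pos.2 h
  rw [ramp, min_eq_right ((div_le_one this).2 (by linarith [hx.2])),
    max_eq_right (div_nonneg (sub_nonneg.2 hx.1) this.le)]

/-- The function with value `W k` at the knot `k` whose transition from `W k` to `W (k + 1)` has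
profile `H k`. -/
noncomputable def interpolant (n : ℕ) (W : ℕ → ℝ) (H : ℕ → ℝ → ℝ) (x : ℝ) : ℝ :=
  W 0 + ∑ j ∈ Finset.range n, (W (j + 1) - W j) * H j x

lemma interpolant_eq {n k : ℕ} {T : ℕ → ℝ} {H : ℕ → ℝ → ℝ} (W : ℕ → ℝ)
    (hT : ∀ j < n, T j < T (j + 1)) (h₀ : ∀ j < n, ∀ x ≤ T j, H j x = 0)
    (h₁ : ∀ j < n, ∀ x, T (j + 1) ≤ x → H j x = 1) (hk : k < n) {x : ℝ}
    (hx : x ∈ Icc (T k) (T (k + 1))) :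
    interpolant n W H x = W k + (W (k + 1) - W k) * H k x := by
  have hsum : ∑ j ∈ Finset.range n, (W (j + 1) - W j) * H j x =
      ∑ j ∈ Finset.range (k + 1), (W (j + 1) - W j) * H j x := by
    refine (Finset.sum_subset (Finset.range_mono hk) fun j hj hj' => ?_).symm
    rw [Finset.mem_range] at hj hj'
    rw [h₀ j hj x (hx.2.trans (knots_le hT (by omega) hj.le)), mul_zero]
  have hone : ∑ j ∈ Finset.range k, (W (j + 1) - W j) * H j x = W k - W 0 := by
    rw [← Finset.sum_range_sub]
    refine Finset.sum_congr rfl fun j hj => ?_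
    rw [Finset.mem_range] at hj
    rw [h₁ j (hj.trans hk) x ((knots_le hT hj hk.le).trans hx.1), mul_one]
  rw [interpolant, hsum, Finset.sum_range_succ, hone]
  ring

lemma continuous_interpolant {n : ℕ} {H : ℕ → ℝ → ℝ} (W : ℕ → ℝ)
    (hH : ∀ j < n, Continuous (H j)) : Continuous (interpolant n W H) :=
  continuous_const.add (continuous_finsetSum _ fun j hj =>
    continuous_const.mul (hH j (Finset.mem_range.1 hj)))

lemma monotone_interpolant {n : ℕ} {W : ℕ → ℝ} {H : ℕ → ℝ → ℝ} (hW : ∀ j < n, W j ≤ W (j + 1))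
    (hH : ∀ j < n, Monotone (H j)) : Monotone (interpolant n W H) := fun x y hxy => by
  refine add_le_add_right (Finset.sum_le_sum fun j hj => ?_) _
  rw [Finset.mem_range] at hj
  exact mul_le_mul_of_nonneg_left (hH j hj hxy) (sub_nonneg.2 (hW j hj))

lemma IsPolyOn.exists_piece {τ : ℝ → ℝ} {m : ℕ} {t w : ℕ → ℝ} (h : IsPolyOn τ m t w) {x : ℝ}
    (hx : x ∈ Icc (0 : ℝ) 1) : ∃ k, k + 1 < m ∧ x ∈ Icc (t k) (t (k + 1)) := by
  obtain ⟨hm, h0, h1, -, -⟩ := h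
  obtain ⟨k, hk, hxk⟩ := exists_knot_interval (T := t) (n := m - 1) (by omega) (h0 ▸ hx.1)
    (h1 ▸ hx.2)
  exact ⟨k, by omega, hxk⟩

lemma IsPolyOn.knot_mem {τ : ℝ → ℝ} {m : ℕ} {t w : ℕ → ℝ} (h : IsPolyOn τ m t w) {k : ℕ}
    (hk : k < m) : t k ∈ Icc (0 : ℝ) 1 := by
  obtain ⟨hm, h0, h1, hlt, -⟩ := h
  have hlt' : ∀ j < m - 1, t j < t (j + 1) := fun j hj => hlt j (by omega)
  exact ⟨h0 ▸ knots_le hlt' (Nat.zero_le k) (by omega), h1 ▸ knots_le hlt' (by omega) le_rfl⟩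

lemma IsPolyOn.apply_knot {τ : ℝ → ℝ} {m : ℕ} {t w : ℕ → ℝ} (h : IsPolyOn τ m t w) {k : ℕ}
    (hk : k + 1 < m) : τ (t k) = w k := by
  simpa using h.2.2.2.2 k hk (t k) ⟨le_rfl, (h.2.2.2.1 k hk).le⟩

lemma IsPolyOn.apply_knot_succ {τ : ℝ → ℝ} {m : ℕ} {t w : ℕ → ℝ} (h : IsPolyOn τ m t w) {k : ℕ}
    (hk : k + 1 < m) : τ (t (k + 1)) = w (k + 1) := by
  have hlt := h.2.2.2.1 k hk
  rw [h.2.2.2.2 k hk _ ⟨hlt.le, le_rfl⟩, div_self (sub_pos.2 hlt).ne']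
  ring

/-- A polygonal curve on `[0, 1]` is the restriction of a continuous function on `ℝ`. -/
lemma IsPolyOn.exists_continuous_eqOn {τ : ℝ → ℝ} {m : ℕ} {t w : ℕ → ℝ} (h : IsPolyOn τ m t w) :
    ∃ τ' : ℝ → ℝ, Continuous τ' ∧ EqOn τ τ' (Icc 0 1) := by
  have hlt : ∀ j < m - 1, t j < t (j + 1) := fun j hj => h.2.2.2.1 j (by omega)
  refine ⟨interpolant (m - 1) w fun j => ramp (t j) (t (j + 1)),
    continuous_interpolant w fun j _ => continuous_ramp _ _, fun x hx => ?_⟩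
  obtain ⟨k, hk, hxk⟩ := h.exists_piece hx
  rw [interpolant_eq w hlt (fun j hj x => ramp_of_le (hlt j hj))
    (fun j hj x => ramp_of_ge (hlt j hj)) (by omega) hxk, h.2.2.2.2 k hk x hxk,
    ramp_of_mem (hlt k (by omega)) hxk, mul_comm]

lemma IsPolyOn.monotoneOn {τ : ℝ → ℝ} {m : ℕ} {t w : ℕ → ℝ} (h : IsPolyOn τ m t w) {k : ℕ}
    (hk : k + 1 < m) (hw : w k ≤ w (k + 1)) : MonotoneOn τ (Icc (t k) (t (k + 1))) := by
  intro x hx y hy hxy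
  have := sub_pos.2 (h.2.2.2.1 k hk)
  rw [h.2.2.2.2 k hk x hx, h.2.2.2.2 k hk y hy]
  have := sub_nonneg.2 hw
  gcongr

lemma IsPolyOn.antitoneOn {τ : ℝ → ℝ} {m : ℕ} {t w : ℕ → ℝ} (h : IsPolyOn τ m t w) {k : ℕ}
    (hk : k + 1 < m) (hw : w (k + 1) ≤ w k) : AntitoneOn τ (Icc (t k) (t (k + 1))) := by
  intro x hx y hy hxy
  have := sub_pos.2 (h.2.2.2.1 k hk)
  rw [h.2.2.2.2 k hk x hx, h.2.2.2.2 k hk y hy, add_le_add_iff_left]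
  exact mul_le_mul_of_nonpos_right (by gcongr) (sub_nonpos.2 hw)

/-- Monotone profile of the clamping of a two-piece curve to the interval between its end values,
ascending case. -/
lemma exists_clamp_profile_of_lt {π : ℝ → ℝ} {a b c : ℝ} (hab : a ≤ b) (hbc : b ≤ c)
    (hcont : ContinuousOn π (Icc a c))
    (hab₁ : π a ≤ π b → MonotoneOn π (Icc a b)) (hab₂ : π b ≤ π a → AntitoneOn π (Icc a b))
    (hbc₁ : π b ≤ π c → MonotoneOn π (Icc b c)) (hbc₂ : π c ≤ π b → AntitoneOn π (Icc b c))
    (hlt : π a < π c) :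
    ∃ K : ℝ → ℝ, Continuous K ∧ Monotone K ∧ (∀ x ≤ a, K x = 0) ∧ (∀ x, c ≤ x → K x = 1) ∧
      ∀ x ∈ Icc a c, π a + (π c - π a) * K x =
        max (min (π a) (π c)) (min (π x) (max (π a) (π c))) := by
  have hac := hab.trans hbc
  set C : ℝ → ℝ := fun x => max (π a) (min (π x) (π c)) with hC
  have hclamp : Monotone fun y => max (π a) (min y (π c)) := fun x y hxy =>
    max_le_max_left _ (min_le_min_right _ hxy)
  have hCab : MonotoneOn C (Icc a b) := by
    rcases le_total (π a) (π b) with h | h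
    · exact hclamp.comp_monotoneOn (hab₁ h)
    · intro x hx y hy _
      have := hab₂ h ⟨le_rfl, hab⟩ hx hx.1
      exact (max_eq_left ((min_le_left _ _).trans this)).le.trans (le_max_left _ _)
  have hCbc : MonotoneOn C (Icc b c) := by
    rcases le_total (π b) (π c) with h | h
    · exact hclamp.comp_monotoneOn (hbc₁ h)
    · intro x hx y hy _
      have := hbc₂ h hy ⟨hbc, le_rfl⟩ hy.2
      exact (max_le hlt.le (min_le_right _ _)).trans
        ((min_eq_right this).ge.trans (le_max_right _ _))
  have hCac : MonotoneOn C (Icc a c) := by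
    rw [← Icc_union_Icc_eq_Icc hab hbc]
    exact hCab.union_right hCbc (isGreatest_Icc hab) (isLeast_Icc hbc)
  have hCcont : ContinuousOn C (Icc a c) :=
    (by fun_prop : Continuous fun y => max (π a) (min y (π c))).comp_continuousOn hcont
  have hpos := sub_pos.2 hlt
  have hmem : ∀ x, max a (min x c) ∈ Icc a c := fun x =>
    ⟨le_max_left _ _, max_le hac (min_le_right _ _)⟩
  refine ⟨fun x => (C (max a (min x c)) - π a) / (π c - π a), ?_, fun x y hxy => ?_,
    fun x hx => ?_, fun x hx => ?_, fun x hx => ?_⟩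
  · exact ((hCcont.comp_continuous (by fun_prop) hmem).sub continuous_const).div_const _
  · have : C (max a (min x c)) ≤ C (max a (min y c)) := hCac (hmem x) (hmem y) (by gcongr)
    dsimp only
    gcongr
  · simp [max_eq_left ((min_le_left x c).trans hx), hC]
  · simp [min_eq_right hx, max_eq_right hac, hC, hlt.le, hpos.ne']
  · dsimp only
    rw [min_eq_left hx.2, max_eq_right hx.1, mul_div_cancel₀ _ hpos.ne', min_eq_left hlt.le,
      max_eq_right hlt.le]
    simp [hC]

/-- Monotone profile of the clamping of a two-piece curve to the interval between its end
values. -/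
lemma exists_clamp_profile {π : ℝ → ℝ} {a b c : ℝ} (hab : a ≤ b) (hbc : b ≤ c) (hac : a < c)
    (hcont : ContinuousOn π (Icc a c))
    (hab₁ : π a ≤ π b → MonotoneOn π (Icc a b)) (hab₂ : π b ≤ π a → AntitoneOn π (Icc a b))
    (hbc₁ : π b ≤ π c → MonotoneOn π (Icc b c)) (hbc₂ : π c ≤ π b → AntitoneOn π (Icc b c)) :
    ∃ K : ℝ → ℝ, Continuous K ∧ Monotone K ∧ (∀ x ≤ a, K x = 0) ∧ (∀ x, c ≤ x → K x = 1) ∧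
      ∀ x ∈ Icc a c, π a + (π c - π a) * K x =
        max (min (π a) (π c)) (min (π x) (max (π a) (π c))) := by
  rcases lt_trichotomy (π a) (π c) with hlt | heq | hgt
  · exact exists_clamp_profile_of_lt hab hbc hcont hab₁ hab₂ hbc₁ hbc₂ hlt
  · refine ⟨ramp a c, continuous_ramp a c, monotone_ramp hac, fun x => ramp_of_le hac,
      fun x => ramp_of_ge hac, fun x _ => ?_⟩
    simp [heq]
  · obtain ⟨K, hK, hKm, hK₀, hK₁, hKe⟩ := exists_clamp_profile_of_lt (π := fun x => -π x) hab hbc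
      hcont.neg (fun h => (hab₂ (neg_le_neg_iff.1 h)).neg)
      (fun h => (hab₁ (neg_le_neg_iff.1 h)).neg)
      (fun h => (hbc₂ (neg_le_neg_iff.1 h)).neg) (fun h => (hbc₁ (neg_le_neg_iff.1 h)).neg)
      (neg_lt_neg hgt)
    refine ⟨K, hK, hKm, hK₀, hK₁, fun x hx => ?_⟩
    have := hKe x hx
    rw [min_neg_neg, max_neg_neg, min_neg_neg, max_neg_neg, max_eq_left hgt.le,
      min_eq_right hgt.le, min_max_distrib_left, min_eq_right hgt.le, max_comm, min_comm] at this
    rw [max_eq_left hgt.le, min_eq_right hgt.le]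
    linarith

/-- The curve obtained by removing the vertex `k + 1` of `π` is a reparametrization of the curve
obtained by clamping `π` between the two neighbours of that vertex. -/
lemma IsPolyOn.exists_shortcut {π π' : ℝ → ℝ} {m k : ℕ} {t t' w : ℕ → ℝ} (hπ : IsPolyOn π m t w)
    (hk : k + 2 < m)
    (hπ' : IsPolyOn π' (m - 1) t' (fun j => if j < k + 1 then w j else w (j + 1))) :
    ∃ g : ℝ → ℝ, Continuous g ∧ Monotone g ∧ g 0 = 0 ∧ g 1 = 1 ∧
      (∀ x ∈ Icc (0 : ℝ) 1, x ≤ t k ∨ t (k + 2) ≤ x → π' (g x) = π x) ∧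
      ∀ x ∈ Icc (t k) (t (k + 2)), π' (g x) =
        max (min (π (t k)) (π (t (k + 2)))) (min (π x) (max (π (t k)) (π (t (k + 2))))) := by
  have hπ0 := hπ
  have hπ0' := hπ'
  obtain ⟨hm, ht0, ht1, hlt, hval⟩ := hπ
  obtain ⟨hm', ht0', ht1', hlt', hval'⟩ := hπ'
  set v : ℕ → ℝ := fun j => if j < k + 1 then w j else w (j + 1) with hv
  set T : ℕ → ℝ := fun j => if j < k + 1 then t j else t (j + 1) with hT
  have hTlo : ∀ j ≤ k, T j = t j := fun j hj => if_pos (by omega)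
  have hThi : ∀ j, k < j → T j = t (j + 1) := fun j hj => if_neg (by omega)
  have hvlo : ∀ j ≤ k, v j = w j := fun j hj => if_pos (by omega)
  have hvhi : ∀ j, k < j → v j = w (j + 1) := fun j hj => if_neg (by omega)
  have hTk : T k = t k := hTlo k le_rfl
  have hTk' : T (k + 1) = t (k + 2) := hThi _ (by omega)
  have hpa : π (t k) = w k := hπ0.apply_knot (by omega)
  have hpb : π (t (k + 1)) = w (k + 1) := hπ0.apply_knot hk
  have hpc : π (t (k + 2)) = w (k + 2) := hπ0.apply_knot_succ hk
  have hab := hlt k (by omega)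
  have hbc := hlt (k + 1) hk
  have hTlt : ∀ j < m - 2, T j < T (j + 1) := by
    intro j hj
    rcases lt_trichotomy j k with h | rfl | h
    · rw [hTlo j h.le, hTlo (j + 1) h]
      exact hlt j (by omega)
    · rw [hTk, hTk']
      exact hab.trans hbc
    · rw [hThi j h, hThi (j + 1) (by omega)]
      exact hlt (j + 1) (by omega)
  have hcont : ContinuousOn π (Icc (t k) (t (k + 2))) := by
    obtain ⟨p, hp, hpe⟩ := hπ0.exists_continuous_eqOn
    exact (hp.continuousOn.congr hpe).mono (Icc_subset_Icc (hπ0.knot_mem (by omega)).1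
      (hπ0.knot_mem hk).2)
  obtain ⟨K, hK, hKm, hK₀, hK₁, hKe⟩ := exists_clamp_profile hab.le hbc.le (hab.trans hbc) hcont
    (fun h => hπ0.monotoneOn (by omega) (by rwa [hpa, hpb] at h))
    (fun h => hπ0.antitoneOn (by omega) (by rwa [hpa, hpb] at h))
    (fun h => hπ0.monotoneOn hk (by rwa [hpb, hpc] at h))
    (fun h => hπ0.antitoneOn hk (by rwa [hpb, hpc] at h))
  set H : ℕ → ℝ → ℝ := fun j => if j = k then K else ramp (T j) (T (j + 1)) with hH
  have hHcont : ∀ j, Continuous (H j) := by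
    intro j
    by_cases h : j = k
    · simpa [hH, h] using hK
    · simpa [hH, h] using continuous_ramp _ _
  have hHmono : ∀ j < m - 2, Monotone (H j) := by
    intro j hj
    by_cases h : j = k
    · simpa [hH, h] using hKm
    · simpa [hH, h] using monotone_ramp (hTlt j hj)
  have hH₀ : ∀ j < m - 2, ∀ x ≤ T j, H j x = 0 := by
    intro j hj x hx
    by_cases h : j = k
    · subst h
      simpa [hH] using hK₀ x (hTk ▸ hx)
    · simpa [hH, h] using ramp_of_le (hTlt j hj) hx
  have hH₁ : ∀ j < m - 2, ∀ x, T (j + 1) ≤ x → H j x = 1 := by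
    intro j hj x hx
    by_cases h : j = k
    · subst h
      simpa [hH] using hK₁ x (hTk' ▸ hx)
    · simpa [hH, h] using ramp_of_ge (hTlt j hj) hx
  have hg : ∀ j < m - 2, ∀ x ∈ Icc (T j) (T (j + 1)),
      interpolant (m - 2) t' H x = t' j + (t' (j + 1) - t' j) * H j x :=
    fun j hj x hx => interpolant_eq t' hTlt hH₀ hH₁ hj hx
  have hpiece : ∀ j < m - 2, ∀ x ∈ Icc (T j) (T (j + 1)),
      π' (interpolant (m - 2) t' H x) = v j + (v (j + 1) - v j) * H j x := by
    intro j hj x hx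
    have h0 : 0 ≤ H j x := hH₀ j hj _ le_rfl ▸ hHmono j hj hx.1
    have h1 : H j x ≤ 1 := hH₁ j hj _ le_rfl ▸ hHmono j hj hx.2
    have hpos := sub_pos.2 (hlt' j (by omega))
    rw [hg j hj x hx, hval' j (by omega) _ ⟨by nlinarith, by nlinarith⟩, add_sub_cancel_left,
      mul_div_cancel_left₀ _ hpos.ne', mul_comm]
  have hmid : ∀ x ∈ Icc (t k) (t (k + 2)), π' (interpolant (m - 2) t' H x) =
      max (min (π (t k)) (π (t (k + 2)))) (min (π x) (max (π (t k)) (π (t (k + 2))))) := by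
    intro x hx
    rw [hpiece k (by omega) x (by rwa [hTk, hTk']), ← hKe x hx, hpa, hpc]
    simp [hv, hH]
  refine ⟨interpolant (m - 2) t' H, continuous_interpolant t' fun j _ => hHcont j,
    monotone_interpolant (fun j hj => (hlt' j (by omega)).le) hHmono, ?_, ?_, fun x hx hxk => ?_,
    hmid⟩
  · have hT0 : T 0 = 0 := (hTlo 0 (by omega)).trans ht0
    rw [hg 0 (by omega) 0 ⟨hT0.le, hT0 ▸ (hTlt 0 (by omega)).le⟩, hH₀ 0 (by omega) 0 hT0.ge, ht0']
    ring
  · obtain ⟨n, rfl⟩ : ∃ n, m = n + 3 := ⟨m - 3, by omega⟩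
    have hT1 : T (n + 1) = 1 := (hThi _ (by omega)).trans ht1
    rw [hg n (by omega) 1 ⟨hT1 ▸ (hTlt n (by omega)).le, hT1.ge⟩, hH₁ n (by omega) 1 hT1.le]
    simpa using ht1'
  · obtain ⟨j, hj, hxj⟩ := exists_knot_interval (T := T) (x := x) (n := m - 2) (by omega)
      (by rw [hTlo 0 (by omega), ht0]; exact hx.1)
      (by rw [hThi _ (by omega), show m - 2 + 1 = m - 1 by omega, ht1]; exact hx.2)
    rcases lt_trichotomy j k with h | rfl | h
    · rw [hpiece j hj x hxj]
      simp only [hH, if_neg h.ne, ramp_of_mem (hTlt j hj) hxj]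
      rw [hTlo j h.le, hTlo (j + 1) h] at hxj ⊢
      rw [hvlo j h.le, hvlo (j + 1) h, hval j (by omega) x hxj, mul_comm]
    · rw [hTk, hTk'] at hxj
      rw [hmid x hxj]
      rcases hxk with hxk | hxk
      · simp [le_antisymm hxk hxj.1]
      · simp [le_antisymm hxj.2 hxk]
    · rw [hpiece j hj x hxj]
      simp only [hH, if_neg h.ne', ramp_of_mem (hTlt j hj) hxj]
      rw [hThi j h, hThi (j + 1) (by omega)] at hxj ⊢
      rw [hvhi j h, hvhi (j + 1) (by omega), hval (j + 1) (by omega) x hxj, mul_comm]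

lemma IsPolyOn.congr {τ τ' : ℝ → ℝ} {m : ℕ} {t w : ℕ → ℝ} (h : IsPolyOn τ m t w)
    (he : EqOn τ τ' (Icc 0 1)) : IsPolyOn τ' m t w :=
  ⟨h.1, h.2.1, h.2.2.1, h.2.2.2.1, fun i hi u hu =>
    (he ⟨(h.knot_mem (by omega)).1.trans hu.1, hu.2.trans (h.knot_mem hi).2⟩).symm.trans
      (h.2.2.2.2 i hi u hu)⟩

lemma frechetDist_le_of_reparam {τ π f : ℝ → ℝ} {κ : ℝ} (hf : IsReparam f)
    (h : ∀ t ∈ Icc (0 : ℝ) 1, |τ (f t) - π t| ≤ κ) : frechetDist τ π ≤ κ := by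
  refine ciInf_le_of_le ⟨0, ?_⟩ ⟨f, hf⟩ (ciSup_le fun t => h t t.2)
  rintro _ ⟨f, rfl⟩
  exact Real.iSup_nonneg fun t => abs_nonneg _

lemma exists_reparam_of_frechetDist_lt {τ π : ℝ → ℝ} {κ : ℝ} (hτ : ContinuousOn τ (Icc 0 1))
    (hπ : ContinuousOn π (Icc 0 1)) (h : frechetDist τ π < κ) :
    ∃ f, IsReparam f ∧ ∀ t ∈ Icc (0 : ℝ) 1, |τ (f t) - π t| ≤ κ := by
  have : Nonempty {f : ℝ → ℝ // IsReparam f} :=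
    ⟨⟨id, continuousOn_id, strictMono_id.strictMonoOn _, rfl, rfl⟩⟩
  obtain ⟨⟨f, hf⟩, hlt⟩ := exists_lt_of_ciInf_lt h
  refine ⟨f, hf, fun t ht => ?_⟩
  have hmaps : MapsTo f (Icc 0 1) (Icc 0 1) := fun x hx =>
    ⟨hf.2.2.1 ▸ hf.2.1.monotoneOn ⟨le_rfl, zero_le_one⟩ hx hx.1,
      hf.2.2.2 ▸ hf.2.1.monotoneOn hx ⟨zero_le_one, le_rfl⟩ hx.2⟩
  have hbdd : BddAbove (range fun t : Icc (0 : ℝ) 1 => |τ (f t) - π t|) := by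
    rw [← image_eq_range (fun t => |τ (f t) - π t|)]
    exact isCompact_Icc.bddAbove_image ((hτ.comp hf.1 hmaps).sub hπ).abs
  exact (le_ciSup hbdd ⟨t, ht⟩).trans hlt.le

/-- A monotone polygonal path in the free space is traversed by a pair of monotone functions. -/
lemma FreePath.exists_parametrization {κ : ℝ} {τ ρ : ℝ → ℝ} {P Q : ℝ × ℝ}
    (h : FreePath κ τ ρ P Q) (hP : |τ P.1 - ρ P.2| ≤ κ) :
    ∃ (T : ℝ) (α β : ℝ → ℝ), 0 ≤ T ∧ Continuous α ∧ Continuous β ∧ Monotone α ∧ Monotone β ∧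
      α 0 = P.1 ∧ β 0 = P.2 ∧ (∀ t, T ≤ t → α t = Q.1) ∧ (∀ t, T ≤ t → β t = Q.2) ∧
      ∀ t ∈ Icc 0 T, |τ (α t) - ρ (β t)| ≤ κ := by
  induction h with
  | refl =>
    exact ⟨0, fun _ => P.1, fun _ => P.2, le_rfl, continuous_const, continuous_const,
      monotone_const, monotone_const, rfl, rfl, fun _ _ => rfl, fun _ _ => rfl, fun _ _ => hP⟩
  | @tail A B _ hAB ih =>
    obtain ⟨T, α, β, hT, hα, hβ, hαm, hβm, hα₀, hβ₀, hα₁, hβ₁, hκ⟩ := ih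
    obtain ⟨h₁, h₂, hseg⟩ := hAB
    have hlt := lt_add_one T
    have hmono : ∀ x y : ℝ, x ≤ y → Monotone fun t => ramp T (T + 1) t * (y - x) :=
      fun x y hxy => (monotone_ramp hlt).mul_const (sub_nonneg.2 hxy)
    refine ⟨T + 1, fun t => α t + ramp T (T + 1) t * (B.1 - A.1),
      fun t => β t + ramp T (T + 1) t * (B.2 - A.2), by linarith,
      hα.add ((continuous_ramp _ _).mul continuous_const),
      hβ.add ((continuous_ramp _ _).mul continuous_const), hαm.add (hmono _ _ h₁),
      hβm.add (hmono _ _ h₂), ?_, ?_, fun t ht => ?_, fun t ht => ?_, fun t ht => ?_⟩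
    · simp [ramp_of_le hlt hT, hα₀]
    · simp [ramp_of_le hlt hT, hβ₀]
    · simp [ramp_of_ge hlt ht, hα₁ t (by linarith)]
    · simp [ramp_of_ge hlt ht, hβ₁ t (by linarith)]
    · rcases le_total t T with h | h
      · simpa [ramp_of_le hlt h] using hκ t ⟨ht.1, h⟩
      · simp only [hα₁ t h, hβ₁ t h, ramp_of_mem hlt ⟨h, ht.2⟩]
        exact hseg _ ⟨div_nonneg (by linarith) (by linarith),
          (div_le_one (by linarith)).2 (by linarith [ht.2])⟩

/-- Traversing both curves monotonically, not necessarily strictly, bounds the Fréchet distance. -/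
lemma frechetDist_le_of_monotone {τ π α β : ℝ → ℝ} {κ : ℝ} (hτ : ContinuousOn τ (Icc 0 1))
    (hπ : ContinuousOn π (Icc 0 1)) (hα : Continuous α) (hβ : Continuous β) (hαm : Monotone α)
    (hβm : Monotone β) (hα₀ : α 0 = 0) (hβ₀ : β 0 = 0) (hα₁ : α 1 = 1) (hβ₁ : β 1 = 1)
    (h : ∀ t ∈ Icc (0 : ℝ) 1, |τ (α t) - π (β t)| ≤ κ) : frechetDist τ π ≤ κ := by
  refine le_of_forall_pos_le_add fun ε hε => ?_
  obtain ⟨η₁, hη₁, hτu⟩ := Metric.uniformContinuousOn_iff.1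
    (isCompact_Icc.uniformContinuousOn_of_continuous hτ) (ε / 2) (half_pos hε)
  obtain ⟨η₂, hη₂, hπu⟩ := Metric.uniformContinuousOn_iff.1
    (isCompact_Icc.uniformContinuousOn_of_continuous hπ) (ε / 2) (half_pos hε)
  obtain ⟨θ, hθ₀, hθ⟩ := exists_between (lt_min one_pos (lt_min hη₁ hη₂))
  obtain ⟨hθ₁, hθη⟩ := lt_min_iff.1 hθ
  obtain ⟨hθη₁, hθη₂⟩ := lt_min_iff.1 hθη
  set p : (ℝ → ℝ) → ℝ → ℝ := fun γ t => (1 - θ) * γ t + θ * t with hp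
  have hpc : ∀ γ, Continuous γ → Continuous (p γ) := fun γ hγ => by fun_prop
  have hpm : ∀ γ, Monotone γ → StrictMono (p γ) := fun γ hγ =>
    (hγ.const_mul (by linarith)).add_strictMono (strictMono_id.const_mul hθ₀)
  have hp₀ : ∀ γ : ℝ → ℝ, γ 0 = 0 → p γ 0 = 0 := fun γ hγ => by simp [hp, hγ]
  have hp₁ : ∀ γ : ℝ → ℝ, γ 1 = 1 → p γ 1 = 1 := fun γ hγ => by simp [hp, hγ]
  have hmem : ∀ γ : ℝ → ℝ, Monotone γ → γ 0 = 0 → γ 1 = 1 → ∀ t ∈ Icc (0 : ℝ) 1,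
      γ t ∈ Icc (0 : ℝ) 1 := fun γ hγ h₀ h₁ t ht => ⟨h₀ ▸ hγ ht.1, h₁ ▸ hγ ht.2⟩
  have hdist : ∀ γ : ℝ → ℝ, Monotone γ → γ 0 = 0 → γ 1 = 1 → ∀ t ∈ Icc (0 : ℝ) 1,
      dist (p γ t) (γ t) ≤ θ := by
    intro γ hγ h₀ h₁ t ht
    have h' := hmem γ hγ h₀ h₁ t ht
    rw [Real.dist_eq, show p γ t - γ t = θ * (t - γ t) by simp only [hp]; ring, abs_mul,
      abs_of_pos hθ₀]
    exact mul_le_of_le_one_right hθ₀.le (abs_le.2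
      ⟨by linarith [ht.1, h'.2], by linarith [ht.2, h'.1]⟩)
  have hsurj : Function.Surjective (p β) := by
    refine (hpc β hβ).surjective ?_ ?_
    · refine Filter.tendsto_atTop_mono' _ ?_ (Filter.tendsto_id.const_mul_atTop hθ₀)
      filter_upwards [Filter.eventually_ge_atTop 0] with t ht
      have : 0 ≤ β t := hβ₀ ▸ hβm ht
      simp only [hp, id]
      nlinarith
    · refine Filter.tendsto_atBot_mono' _ ?_ (Filter.tendsto_id.const_mul_atBot hθ₀)
      filter_upwards [Filter.eventually_le_atBot 0] with t ht
      have : β t ≤ 0 := hβ₀ ▸ hβm ht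
      simp only [hp, id]
      nlinarith
  set e := (hpm β hβm).orderIsoOfSurjective _ hsurj with he
  have hes : ∀ y, p β (e.symm y) = y := fun y => e.apply_symm_apply y
  have he₀ : e.symm 0 = 0 := e.symm_apply_eq.2 (hp₀ β hβ₀).symm
  have he₁ : e.symm 1 = 1 := e.symm_apply_eq.2 (hp₁ β hβ₁).symm
  refine frechetDist_le_of_reparam (f := p α ∘ e.symm)
    ⟨((hpc α hα).comp e.symm.continuous).continuousOn,
      ((hpm α hαm).comp e.symm.strictMono).strictMonoOn _, by simp [he₀, hp₀ α hα₀],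
      by simp [he₁, hp₁ α hα₁]⟩ fun y hy => ?_
  have ht : e.symm y ∈ Icc (0 : ℝ) 1 := ⟨he₀ ▸ e.symm.monotone hy.1, he₁ ▸ e.symm.monotone hy.2⟩
  have h₁ := hτu _ (hmem _ (hpm α hαm).monotone (hp₀ α hα₀) (hp₁ α hα₁) _ ht) _
    (hmem α hαm hα₀ hα₁ _ ht) ((hdist α hαm hα₀ hα₁ _ ht).trans_lt hθη₁)
  have h₂ := hπu _ (hmem _ (hpm β hβm).monotone (hp₀ β hβ₀) (hp₁ β hβ₁) _ ht) _
    (hmem β hβm hβ₀ hβ₁ _ ht) ((hdist β hβm hβ₀ hβ₁ _ ht).trans_lt hθη₂)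
  have h₃ := h _ ht
  rw [hes] at h₂
  rw [Real.dist_eq, abs_lt] at h₁ h₂
  rw [abs_le] at h₃ ⊢
  rw [Function.comp_apply]
  constructor <;> linarith

lemma IsSignature.comp_reparam {δ : ℝ} {τ τ' f : ℝ → ℝ} {l : ℕ} {s : ℕ → ℝ}
    (h : IsSignature δ τ l s) (hf : IsReparam f) (hτ' : ∀ x ∈ Icc (0 : ℝ) 1, τ' x = τ (f x)) :
    ∃ S, IsSignature δ τ' l S ∧ ∀ j < l, τ' (S j) = τ (s j) := by
  obtain ⟨hl, hs0, hs1, hlt, hnd, hdir, hlen, hlen0, hlen1, hr, hr0, hr1, hr2⟩ := h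
  obtain ⟨hfc, hfm, hf0, hf1⟩ := hf
  have hs : ∀ j < l, s j ∈ Icc (0 : ℝ) 1 := by
    have hlt' : ∀ j < l - 1, s j < s (j + 1) := fun j hj => hlt j (by omega)
    exact fun j hj => ⟨hs0 ▸ knots_le hlt' (Nat.zero_le j) (by omega),
      hs1 ▸ knots_le hlt' (by omega) le_rfl⟩
  have hex : ∀ j, ∃ x, j < l → x ∈ Icc (0 : ℝ) 1 ∧ f x = s j := by
    intro j
    by_cases hj : j < l
    · obtain ⟨x, hx, hxs⟩ := intermediate_value_Icc zero_le_one hfc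
        (show s j ∈ Icc (f 0) (f 1) by rw [hf0, hf1]; exact hs j hj)
      exact ⟨x, fun _ => ⟨hx, hxs⟩⟩
    · exact ⟨0, fun h => absurd h hj⟩
  choose S hS using hex
  have hSτ : ∀ j < l, τ' (S j) = τ (s j) := fun j hj => by
    rw [hτ' _ (hS j hj).1, (hS j hj).2]
  have hIcc : ∀ i, i + 1 < l → ∀ a ∈ Icc (S i) (S (i + 1)), a ∈ Icc (0 : ℝ) 1 :=
    fun i hi a ha => ⟨(hS i (by omega)).1.1.trans ha.1, ha.2.trans (hS (i + 1) hi).1.2⟩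
  have hmaps : ∀ i, i + 1 < l → ∀ a ∈ Icc (S i) (S (i + 1)), f a ∈ Icc (s i) (s (i + 1)) := by
    intro i hi a ha
    have h1 := hS i (by omega)
    have h2 := hS (i + 1) hi
    exact ⟨h1.2 ▸ hfm.monotoneOn h1.1 (hIcc i hi a ha) ha.1,
      h2.2 ▸ hfm.monotoneOn (hIcc i hi a ha) h2.1 ha.2⟩
  have h0 : τ' (S 0) = τ (s 0) := hSτ 0 (by omega)
  have h1 : τ' (S 1) = τ (s 1) := hSτ 1 (by omega)
  have hL : τ' (S (l - 1)) = τ (s (l - 1)) := hSτ (l - 1) (by omega)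
  have hL' : τ' (S (l - 2)) = τ (s (l - 2)) := hSτ (l - 2) (by omega)
  have e : l - 2 + 1 = l - 1 := by omega
  have hSlast : ∀ a ∈ Icc (S (l - 2)) (S (l - 1)),
      τ' a = τ (f a) ∧ f a ∈ Icc (s (l - 2)) (s (l - 1)) := by
    intro a ha
    rw [← e] at ha ⊢
    exact ⟨hτ' a (hIcc _ (by omega) a ha), hmaps _ (by omega) a ha⟩
  refine ⟨S, ⟨hl, ?_, ?_, fun i hi => ?_, fun i hi hi' => ?_, fun i hi a b ha hab hb => ?_,
    fun i hi hi' => ?_, by rwa [h0, h1], by rwa [hL, hL'], fun i hi hi' a ha => ?_,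
    fun h a ha => ?_, fun h a ha => ?_, fun h a ha => ?_⟩, hSτ⟩
  · have := hS 0 (by omega)
    exact hfm.injOn this.1 ⟨le_rfl, zero_le_one⟩ (by rw [this.2, hf0, hs0])
  · have := hS (l - 1) (by omega)
    exact hfm.injOn this.1 ⟨zero_le_one, le_rfl⟩ (by rw [this.2, hf1, hs1])
  · have h1 := hS i (by omega)
    have h2 := hS (i + 1) hi
    exact (hfm.lt_iff_lt h1.1 h2.1).1 (by rw [h1.2, h2.2]; exact hlt i hi)
  · rw [hSτ i (by omega), hSτ (i - 1) (by omega), hSτ (i + 1) hi']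
    exact hnd i hi hi'
  · have ha' : a ∈ Icc (S i) (S (i + 1)) := ⟨ha, hab.le.trans hb⟩
    have hb' : b ∈ Icc (S i) (S (i + 1)) := ⟨ha.trans hab.le, hb⟩
    rw [hSτ i (by omega), hSτ (i + 1) hi, hτ' a (hIcc i hi a ha'), hτ' b (hIcc i hi b hb')]
    exact hdir i hi _ _ (hmaps i hi a ha').1 (hfm (hIcc i hi a ha') (hIcc i hi b hb') hab)
      (hmaps i hi b hb').2
  · rw [hSτ i (by omega), hSτ (i + 1) (by omega)]
    exact hlen i hi hi'
  · rw [hSτ i (by omega), hSτ (i + 1) (by omega), hτ' a (hIcc i (by omega) a ha)]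
    exact hr i hi hi' _ (hmaps i (by omega) a ha)
  · rw [h0, h1, hτ' a (hIcc 0 (by omega) a ha)]
    exact hr0 h _ (hmaps 0 (by omega) a ha)
  · rw [hL, hL', (hSlast a ha).1]
    exact hr1 h _ (hSlast a ha).2
  · rw [h0, h1, hτ' a (hIcc 0 (by omega) a ha)]
    exact hr2 h _ (hmaps 0 (by omega) a ha)

open Filter Topology in
/-- A signature for `δ` is a signature for all slightly larger values. -/
lemma IsSignature.eventually {δ : ℝ} {τ : ℝ → ℝ} {l : ℕ} {s : ℕ → ℝ} (h : IsSignature δ τ l s) :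
    ∀ᶠ δ' in 𝓝[>] δ, IsSignature δ' τ l s := by
  obtain ⟨hl, hs0, hs1, hlt, hnd, hdir, hlen, hlen0, hlen1, hr, hr0, hr1, hr2⟩ := h
  have hall : ∀ᶠ δ' in 𝓝[>] δ, ∀ i ∈ Finset.range l, 1 ≤ i → i + 3 ≤ l →
      2 * δ' < |τ (s (i + 1)) - τ (s i)| := by
    refine (eventually_all_finset _).2 fun i _ => ?_
    by_cases hi : 1 ≤ i ∧ i + 3 ≤ l
    · have : ∀ᶠ δ' in 𝓝 δ, 2 * δ' < |τ (s (i + 1)) - τ (s i)| :=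
        (by fun_prop : ContinuousAt (fun x : ℝ => 2 * x) δ).eventually_lt_const
          (hlen i hi.1 hi.2)
      filter_upwards [nhdsWithin_le_nhds this] with x hx _ _ using hx
    · exact Eventually.of_forall fun x h1 h2 => absurd ⟨h1, h2⟩ hi
  filter_upwards [hall, nhdsWithin_le_nhds (eventually_lt_nhds hlen0),
    nhdsWithin_le_nhds (eventually_lt_nhds hlen1), self_mem_nhdsWithin] with x hx hx0 hx1 hδx
  rw [mem_Ioi] at hδx
  have hmono : ∀ y, Icc (y - δ) (y + δ) ⊆ Icc (y - x) (y + x) := fun y =>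
    Icc_subset_Icc (by linarith) (by linarith)
  refine ⟨hl, hs0, hs1, hlt, hnd, fun i hi a b ha hab hb => ?_,
    fun i hi hi' => hx i (Finset.mem_range.2 (by omega)) hi hi', hx0, hx1, hr,
    fun hl a ha => (hr0 hl a ha).imp id (@hmono _ _),
    fun hl a ha => (hr1 hl a ha).imp id (@hmono _ _),
    fun hl a ha => (hr2 hl a ha).imp (Or.imp id (@hmono _ _)) (@hmono _ _)⟩
  have := hdir i hi a b ha hab hb
  exact ⟨fun h => (this.1 h).trans (by linarith), fun h => (this.2 h).trans (by linarith)⟩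

open Filter Topology in
lemma eventually_notMem_Icc {u v k δ : ℝ} (h : u ∉ Icc (v - k * δ) (v + k * δ)) :
    ∀ᶠ δ' in 𝓝[>] δ, u ∉ Icc (v - k * δ') (v + k * δ') := by
  simp only [← mem_Icc_iff_abs_le, not_le] at h ⊢
  exact nhdsWithin_le_nhds
    ((by fun_prop : ContinuousAt (fun x : ℝ => k * x) δ).eventually_lt_const h)

open Filter Topology in
lemma eventually_forall_notMem_Icc {u δ : ℝ} {v : ℕ → ℝ} {l : ℕ}
    (h : ∀ j, 1 ≤ j → j + 1 < l → u ∉ Icc (v j - δ) (v j + δ)) :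
    ∀ᶠ δ' in 𝓝[>] δ, ∀ j, 1 ≤ j → j + 1 < l → u ∉ Icc (v j - δ') (v j + δ') := by
  have hall : ∀ᶠ δ' in 𝓝[>] δ, ∀ j ∈ Finset.Ico 1 (l - 1), u ∉ Icc (v j - δ') (v j + δ') := by
    refine (eventually_all_finset _).2 fun j hj => ?_
    rw [Finset.mem_Ico] at hj
    simpa using eventually_notMem_Icc (k := 1) (by simpa using h j hj.1 (by omega))
  filter_upwards [hall] with δ' hδ' j hj hj'
  exact hδ' j (Finset.mem_Ico.2 ⟨hj, by omega⟩)

/-- Theorem 3.1, vertex removal: let `σ` (parameters `s`) be a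
`δ`-signature of the polygonal curve `τ`, with ranges `[v_j - δ, v_j + δ]` around
the interior signature vertices and `[v - 4δ, v + 4δ]` around the two endpoint
signature vertices. If `π` is a polygonal curve with `d_F(τ, π) ≤ δ` and `π'` is
obtained from `π` by removing one interior vertex `w' i` lying in none of the
ranges, then `d_F(τ, π') ≤ δ`. -/
theorem remove_one_vertex (δ : ℝ) (hδ : 0 ≤ δ)
    (τ : ℝ → ℝ) (m : ℕ) (t w : ℕ → ℝ) (hτ : IsPolyOn τ m t w)
    (ℓ : ℕ) (s : ℕ → ℝ) (hsig : IsSignature δ τ ℓ s)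
    (hvert : ∀ i, i < ℓ → ∃ j, j < m ∧ s i = t j)
    (π : ℝ → ℝ) (m' : ℕ) (t' w' : ℕ → ℝ) (hπ : IsPolyOn π m' t' w')
    (hd : frechetDist τ π ≤ δ)
    (i : ℕ) (hi0 : 0 < i) (him : i + 1 < m')
    (hint : ∀ j, 1 ≤ j → j + 1 < ℓ → w' i ∉ Set.Icc (τ (s j) - δ) (τ (s j) + δ))
    (hend0 : w' i ∉ Set.Icc (τ (s 0) - 4 * δ) (τ (s 0) + 4 * δ))
    (hend1 : w' i ∉ Set.Icc (τ (s (ℓ - 1)) - 4 * δ) (τ (s (ℓ - 1)) + 4 * δ))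
    (π' : ℝ → ℝ) (t'' : ℕ → ℝ)
    (hπ' : IsPolyOn π' (m' - 1) t'' (fun j => if j < i then w' j else w' (j + 1))) :
    frechetDist τ π' ≤ δ := by
  obtain ⟨k, rfl⟩ : ∃ k, i = k + 1 := ⟨i - 1, by omega⟩
  obtain ⟨τc, hτc, hττ⟩ := hτ.exists_continuous_eqOn
  obtain ⟨πc, hπc, hππ⟩ := hπ.exists_continuous_eqOn
  obtain ⟨σ, hσ, hσπ⟩ := hπ'.exists_continuous_eqOn
  have hτcont : ContinuousOn τ (Icc 0 1) := hτc.continuousOn.congr hττ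
  have hπcont : ContinuousOn π (Icc 0 1) := hπc.continuousOn.congr hππ
  have hπ'cont : ContinuousOn π' (Icc 0 1) := hσ.continuousOn.congr hσπ
  have hP := hπ.congr hππ
  obtain ⟨g, hg, hgm, hg0, hg1, hgout, hgin⟩ := hP.exists_shortcut him (hπ'.congr hσπ)
  have hpa : πc (t' k) = w' k := hP.apply_knot (by omega)
  have hpb : πc (t' (k + 1)) = w' (k + 1) := hP.apply_knot him
  have hpc : πc (t' (k + 2)) = w' (k + 2) := hP.apply_knot_succ him
  refine ge_of_tendsto (Filter.tendsto_id.mono_left (nhdsWithin_le_nhds (s := Ioi δ))) ?_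
  filter_upwards [hsig.eventually, eventually_forall_notMem_Icc hint,
    eventually_notMem_Icc hend0, eventually_notMem_Icc hend1,
    self_mem_nhdsWithin] with δ' hsig' hint' hend0' hend1' hδδ'
  rw [mem_Ioi] at hδδ'
  refine le_of_forall_gt_imp_ge_of_dense fun κ hκ => ?_
  obtain ⟨f, hf, hfd⟩ := exists_reparam_of_frechetDist_lt hτcont hπcont (hd.trans_lt hδδ')
  have hclamp : ∀ x : ℝ, max 0 (min x 1) ∈ Icc (0 : ℝ) 1 := fun x =>
    ⟨le_max_left _ _, max_le zero_le_one (min_le_right _ _)⟩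
  have hclamp' : ∀ x ∈ Icc (0 : ℝ) 1, max 0 (min x 1) = x := fun x hx => by
    rw [min_eq_left hx.2, max_eq_right hx.1]
  set F : ℝ → ℝ := fun x => f (max 0 (min x 1)) with hF
  have hFc : Continuous F := hf.1.comp_continuous (by fun_prop) hclamp
  have hFm : Monotone F := fun x y hxy =>
    hf.2.1.monotoneOn (hclamp x) (hclamp y) (max_le_max_left _ (min_le_min_right _ hxy))
  have hF0 : F 0 = 0 := by simp [hF, hf.2.2.1]
  have hF1 : F 1 = 1 := by simp [hF, hf.2.2.2]
  have hFmem : ∀ x ∈ Icc (0 : ℝ) 1, F x ∈ Icc (0 : ℝ) 1 := fun x hx =>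
    ⟨hF0 ▸ hFm hx.1, hF1 ▸ hFm hx.2⟩
  have hgmem : ∀ x ∈ Icc (0 : ℝ) 1, g x ∈ Icc (0 : ℝ) 1 := fun x hx =>
    ⟨hg0 ▸ hgm hx.1, hg1 ▸ hgm hx.2⟩
  have hτF : ∀ x ∈ Icc (0 : ℝ) 1, τc (F x) = τ (f x) := fun x hx => by
    rw [← hττ (hFmem x hx)]
    simp only [hF, hclamp' x hx]
  obtain ⟨S, hS, hSτ⟩ := hsig'.comp_reparam hf (τ' := τc ∘ F) hτF
  have hl := hS.1
  have hclose : ∀ x ∈ Icc (0 : ℝ) 1, |(τc ∘ F) x - πc x| ≤ δ' := fun x hx => by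
    rw [Function.comp_apply, hτF x hx, ← hππ hx]
    exact hfd x hx
  have hpath : FreePath κ (τc ∘ F) (σ ∘ g) (0, 0) (1, 1) := by
    refine freePath_of_vertex (hτc.comp hFc) hπc (hσ.comp hg) (hδ.trans hδδ'.le) hκ hS
      (hP.knot_mem (by omega)).1 (hP.2.2.2.1 k (by omega)).le (hP.2.2.2.1 (k + 1) him).le
      (hP.knot_mem him).2 hclose
      (fun h => hP.monotoneOn (by omega) (by rwa [hpa, hpb] at h))
      (fun h => hP.antitoneOn (by omega) (by rwa [hpa, hpb] at h))
      (fun h => hP.monotoneOn him (by rwa [hpb, hpc] at h))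
      (fun h => hP.antitoneOn him (by rwa [hpb, hpc] at h)) hgout hgin (fun j hj hj' => ?_) ?_ ?_
    · rw [hpb, hSτ j (by omega)]
      exact hint' j hj hj'
    · rwa [hpb, hSτ 0 (by omega)]
    · rwa [hpb, hSτ (ℓ - 1) (by omega)]
  have hstart : |(τc ∘ F) 0 - (σ ∘ g) 0| ≤ κ := by
    have h0 : (0 : ℝ) ∈ Icc (0 : ℝ) 1 := ⟨le_rfl, zero_le_one⟩
    rw [Function.comp_apply (f := σ), hgout 0 h0 (Or.inl (hP.knot_mem (by omega)).1)]
    exact (hclose 0 h0).trans hκ.le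
  obtain ⟨T, α, β, hT, hα, hβ, hαm, hβm, hα0, hβ0, hα1, hβ1, hαβ⟩ :=
    hpath.exists_parametrization hstart
  have hTm : Monotone fun x : ℝ => T * x := monotone_id.const_mul hT
  refine frechetDist_le_of_monotone (α := fun x => F (α (T * x))) (β := fun x => g (β (T * x)))
    hτcont hπ'cont (by fun_prop) (by fun_prop) (hFm.comp (hαm.comp hTm))
    (hgm.comp (hβm.comp hTm)) (by simp [hα0, hF0]) (by simp [hβ0, hg0])
    (by simp [hα1 T le_rfl, hF1]) (by simp [hβ1 T le_rfl, hg1]) fun x hx => ?_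
  have hx' : T * x ∈ Icc 0 T := ⟨mul_nonneg hT hx.1, mul_le_of_le_one_right hT hx.2⟩
  have hαmem : α (T * x) ∈ Icc (0 : ℝ) 1 :=
    ⟨hα0.ge.trans (hαm hx'.1), (hαm hx'.2).trans (hα1 T le_rfl).le⟩
  have hβmem : β (T * x) ∈ Icc (0 : ℝ) 1 :=
    ⟨hβ0.ge.trans (hβm hx'.1), (hβm hx'.2).trans (hβ1 T le_rfl).le⟩
  rw [hττ (hFmem _ hαmem), hσπ (hgmem _ hβmem)]
  exact hαβ _ hx'
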